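/- Let d ≥ 6 and p_c = (d+2)/(d−2). There exist a real number e₀ > 0 and nonzero Schwartz functions 𝒴₊, 𝒴₋ : ℝ^d → ℂ with 𝒴₊ equal to the complex conjugate of 𝒴₋, such that ℒ𝒴₊ = e₀ 𝒴₊ and ℒ𝒴₋ = −e₀ 𝒴₋, where ℒ is the linearized operator ℒv := −iΔv − i((p_c+1)/2) W^{p_c−1} v − i((p_c−1)/2) W^{p_c−1} v̄. -/

import Mathlib

open MeasureTheory
open scoped ENNReal

noncomputable section

/-- ℝ^d as Euclidean space -/
abbrev Euc (d : ℕ) := EuclideanSpace ℝ (Fin d)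

/-- The ground state W(x) = (1 + |x|²/(d(d−2)))^{−(d−2)/2}. -/
def Wgs (d : ℕ) (x : Euc d) : ℝ :=
  (1 + ‖x‖ ^ 2 / ((d : ℝ) * ((d : ℝ) - 2))) ^ (-(((d : ℝ) - 2) / 2))

/-- p_c = (d+2)/(d-2) -/
def pc (d : ℕ) : ℝ := ((d : ℝ) + 2) / ((d : ℝ) - 2)

/-- The Laplacian of a complex-valued function on ℝ^d. -/
def lap {d : ℕ} (f : Euc d → ℂ) (x : Euc d) : ℂ :=
  ∑ i : Fin d,
    iteratedFDeriv ℝ 2 f x ![EuclideanSpace.single i 1, EuclideanSpace.single i 1]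

/-- The linearized operator ℒv = −iΔv − i((p_c+1)/2)W^{p_c−1}v − i((p_c−1)/2)W^{p_c−1}v̄. -/
def Lop (d : ℕ) (v : Euc d → ℂ) (x : Euc d) : ℂ :=
  -Complex.I * lap v x
    - Complex.I * (↑((pc d + 1) / 2 * (Wgs d x) ^ (pc d - 1)) : ℂ) * v x
    - Complex.I * (↑((pc d - 1) / 2 * (Wgs d x) ^ (pc d - 1)) : ℂ) * (starRingEnd ℂ (v x))

section Symbols

open scoped ContDiff

variable {E F : Type*} [NormedAddCommGroup E] [NormedSpace ℝ E]
  [NormedAddCommGroup F] [NormedSpace ℝ F]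

/-- Smooth functions whose derivatives of order at most `N` are `O((1 + ‖x‖) ^ m)`. -/
def IsSymbolUpTo (N : ℕ) (m : ℤ) (a : E → F) : Prop :=
  ContDiff ℝ ∞ a ∧ ∀ n ≤ N, ∃ C, ∀ x, ‖iteratedFDeriv ℝ n a x‖ ≤ C * (1 + ‖x‖) ^ m

/-- Smooth functions all of whose derivatives are `O((1 + ‖x‖) ^ m)`. -/
def IsSymbol (m : ℤ) (a : E → F) : Prop := ∀ N, IsSymbolUpTo N m a

theorem IsSymbol.contDiff {m : ℤ} {a : E → F} (h : IsSymbol m a) : ContDiff ℝ ∞ a := (h 0).1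

theorem IsSymbol.mono {m m' : ℤ} {a : E → F} (h : IsSymbol m a) (hm : m ≤ m') :
    IsSymbol m' a := by
  refine fun N => ⟨h.contDiff, fun n hn => ?_⟩
  obtain ⟨C, hC⟩ := (h N).2 n hn
  refine ⟨|C|, fun x => (hC x).trans ?_⟩
  have h1 : (1 : ℝ) ≤ 1 + ‖x‖ := by simp
  calc C * (1 + ‖x‖) ^ m ≤ |C| * (1 + ‖x‖) ^ m := by gcongr; exact le_abs_self C
    _ ≤ _ := by gcongr

theorem IsSymbol.norm_le {m : ℤ} {a : E → F} (h : IsSymbol m a) :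
    ∃ C, ∀ x, ‖a x‖ ≤ C * (1 + ‖x‖) ^ m := by
  simpa using (h 0).2 0 le_rfl

theorem IsSymbol.hasTemperateGrowth {m : ℤ} {a : E → F} (h : IsSymbol m a) :
    a.HasTemperateGrowth := by
  refine ⟨h.contDiff, fun n => ?_⟩
  obtain ⟨C, hC⟩ := ((h.mono (Int.self_le_toNat m)) n).2 n le_rfl
  exact ⟨m.toNat, C, fun x => by simpa only [zpow_natCast] using hC x⟩

theorem IsSymbolUpTo.add {N : ℕ} {m : ℤ} {a b : E → F} (ha : IsSymbolUpTo N m a)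
    (hb : IsSymbolUpTo N m b) : IsSymbolUpTo N m (fun x => a x + b x) := by
  refine ⟨ha.1.add hb.1, fun n hn => ?_⟩
  obtain ⟨C, hC⟩ := ha.2 n hn
  obtain ⟨D, hD⟩ := hb.2 n hn
  refine ⟨C + D, fun x => ?_⟩
  rw [fun_iteratedFDeriv_add_apply (ha.1.of_le (by exact_mod_cast le_top)).contDiffAt
    (hb.1.of_le (by exact_mod_cast le_top)).contDiffAt, add_mul]
  exact (norm_add_le _ _).trans (add_le_add (hC x) (hD x))

theorem IsSymbolUpTo.neg {N : ℕ} {m : ℤ} {a : E → F} (ha : IsSymbolUpTo N m a) :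
    IsSymbolUpTo N m (fun x => - a x) := by
  refine ⟨ha.1.neg, fun n hn => ?_⟩
  obtain ⟨C, hC⟩ := ha.2 n hn
  exact ⟨C, fun x => by
    rw [show (fun x => -a x) = -a from rfl, iteratedFDeriv_neg_apply, norm_neg]; exact hC x⟩

theorem IsSymbolUpTo.smul [NormedSpace ℂ F] [IsScalarTower ℝ ℂ F] {N : ℕ} {m m' : ℤ}
    {a : E → ℂ} {b : E → F} (ha : IsSymbolUpTo N m a) (hb : IsSymbolUpTo N m' b) :
    IsSymbolUpTo N (m + m') (fun x => a x • b x) := by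
  refine ⟨ha.1.smul hb.1, fun n hn => ?_⟩
  choose! C hC using ha.2
  choose! D hD using hb.2
  refine ⟨∑ i ∈ Finset.range (n + 1), n.choose i * |C i| * |D (n - i)|, fun x => ?_⟩
  refine (norm_iteratedFDeriv_smul_le ha.1 hb.1 x (by exact_mod_cast le_top)).trans ?_
  rw [Finset.sum_mul]
  refine Finset.sum_le_sum fun i hi => ?_
  have hi' : i ≤ n := Finset.mem_range_succ_iff.1 hi
  have h0 : 1 + ‖x‖ ≠ 0 := by positivity
  have h1 := (hC i (hi'.trans hn) x).trans
    (mul_le_mul_of_nonneg_right (le_abs_self _) (by positivity))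
  have h2 := (hD (n - i) ((Nat.sub_le _ _).trans hn) x).trans
    (mul_le_mul_of_nonneg_right (le_abs_self _) (by positivity))
  calc _ ≤ n.choose i * (|C i| * (1 + ‖x‖) ^ m) * (|D (n - i)| * (1 + ‖x‖) ^ m') := by gcongr
    _ = _ := by rw [zpow_add₀ h0]; ring

theorem IsSymbol.add {m : ℤ} {a b : E → F} (ha : IsSymbol m a) (hb : IsSymbol m b) :
    IsSymbol m (fun x => a x + b x) := fun N => (ha N).add (hb N)

theorem IsSymbol.mul {m m' : ℤ} {a b : E → ℂ} (ha : IsSymbol m a) (hb : IsSymbol m' b) :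
    IsSymbol (m + m') (fun x => a x * b x) := fun N => (ha N).smul (hb N)

theorem IsSymbol.const (c : F) : IsSymbol 0 (fun _ : E => c) := by
  refine fun N => ⟨contDiff_const, fun n _ => ⟨‖c‖, fun x => ?_⟩⟩
  rcases n with _ | n
  · simp
  · simp [iteratedFDeriv_succ_const]

theorem IsSymbol.zero {m : ℤ} : IsSymbol m (fun _ : E => (0 : F)) :=
  fun _ => ⟨contDiff_const, fun n _ => ⟨0, fun x => by simp⟩⟩

theorem IsSymbol.const_mul {m : ℤ} {a : E → ℂ} (ha : IsSymbol m a) (c : ℂ) :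
    IsSymbol m (fun x => c * a x) := by
  simpa using (IsSymbol.const (E := E) c).mul ha

theorem IsSymbol.sum {ι : Type*} {m : ℤ} {s : Finset ι} {a : ι → E → ℂ}
    (h : ∀ i ∈ s, IsSymbol m (a i)) : IsSymbol m (fun x => ∑ i ∈ s, a i x) := by
  classical
  induction s using Finset.induction_on with
  | empty => simpa using IsSymbol.zero
  | insert i s hi ih =>
    simp_rw [Finset.sum_insert hi]
    exact (h i (by simp)).add (ih fun j hj => h j (by simp [hj]))

theorem IsSymbol.pow {m : ℤ} {a : E → ℂ} (ha : IsSymbol m a) (k : ℕ) :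
    IsSymbol (m * k) (fun x => a x ^ k) := by
  induction k with
  | zero => simpa using IsSymbol.const (E := E) (1 : ℂ)
  | succ k ih =>
    have := ih.mul ha
    simp_rw [pow_succ]
    convert this using 1
    push_cast; ring

theorem ContinuousLinearMap.isSymbol (ℓ : E →L[ℝ] F) : IsSymbol 1 ℓ := by
  refine fun N => ⟨ℓ.contDiff, fun n _ => ⟨‖ℓ‖, fun x => ?_⟩⟩
  have h1 : (1 : ℝ) ≤ 1 + ‖x‖ := by simp
  rcases n with _ | _ | n
  · simp only [norm_iteratedFDeriv_zero, zpow_one]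
    exact (ℓ.le_opNorm x).trans (by gcongr; simp)
  · rw [← norm_iteratedFDeriv_fderiv, norm_iteratedFDeriv_zero]
    simp only [ContinuousLinearMap.fderiv, zpow_one]
    nlinarith [norm_nonneg ℓ]
  · rw [← norm_iteratedFDeriv_fderiv, show fderiv ℝ ℓ = fun _ => ℓ by ext1 y; simp]
    simp only [iteratedFDeriv_succ_const, Pi.zero_apply, norm_zero]
    positivity

theorem IsSymbolUpTo.fderiv {N : ℕ} {m : ℤ} {a : E → F} (ha : IsSymbolUpTo (N + 1) m a) :
    IsSymbolUpTo N m (fderiv ℝ a) := by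
  refine ⟨(ha.1.fderiv_right (m := ∞) (by simp)), fun n hn => ?_⟩
  obtain ⟨C, hC⟩ := ha.2 (n + 1) (by omega)
  exact ⟨C, fun x => by simpa [norm_iteratedFDeriv_fderiv] using hC x⟩

theorem IsSymbol.fderiv_apply {m : ℤ} {a : E → F} (ha : IsSymbol m a) (v : E) :
    IsSymbol m (fun x => fderiv ℝ a x v) := by
  intro N
  have h := (ha (N + 1)).fderiv
  refine ⟨h.1.clm_apply contDiff_const, fun n hn => ?_⟩
  obtain ⟨C, hC⟩ := h.2 n hn
  refine ⟨‖v‖ * C, fun x => ?_⟩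
  have := (ContinuousLinearMap.apply ℝ F v).norm_iteratedFDeriv_comp_left (f := fderiv ℝ a)
    (x := x) (n := n) h.1.contDiffAt (by exact_mod_cast le_top)
  refine this.trans ?_
  rw [mul_assoc]
  gcongr
  · exact ContinuousLinearMap.opNorm_le_bound _ (norm_nonneg v)
      fun ℓ => by simpa [mul_comm] using ℓ.le_opNorm v
  · exact hC x

theorem IsSymbol.inv {m : ℤ} {a : E → ℂ} (ha : IsSymbol m a) {c : ℝ} (hc : 0 < c)
    (h : ∀ x, c * (1 + ‖x‖) ^ m ≤ ‖a x‖) : IsSymbol (-m) (fun x => (a x)⁻¹) := by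
  have h0 : ∀ x, a x ≠ 0 := fun x hx => by
    have h1 := h x
    have h2 : 0 < c * (1 + ‖x‖) ^ m := by positivity
    simp only [hx, norm_zero] at h1
    linarith
  have hs : ContDiff ℝ ∞ (fun x => (a x)⁻¹) := ha.contDiff.inv h0
  have hd : fderiv ℝ (fun x => (a x)⁻¹) = fun x => (-((a x)⁻¹ * (a x)⁻¹)) • fderiv ℝ a x := by
    ext1 x
    have h1 := (ha.contDiff.differentiable (by simp) x).hasFDerivAt
    have h2 := (hasDerivAt_inv (h0 x)).comp_hasFDerivAt_of_eq x h1 rfl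
    have h3 := h2.fderiv
    simp only [Function.comp_def] at h3
    rw [h3]; congr 1; field_simp
  intro N
  induction N with
  | zero =>
    refine ⟨hs, fun n hn => ⟨c⁻¹, fun x => ?_⟩⟩
    obtain rfl : n = 0 := by omega
    rw [norm_iteratedFDeriv_zero, norm_inv, zpow_neg, ← mul_inv]
    gcongr
    exact h x
  | succ N ih =>
    refine ⟨hs, fun n hn => ?_⟩
    rcases n with _ | n
    · exact ih.2 0 (by omega)
    · have h1 : IsSymbolUpTo N _ _ := ((ih.smul ih).neg.smul (ha (N + 1)).fderiv)
      obtain ⟨C, hC⟩ := h1.2 n (by omega)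
      refine ⟨C, fun x => ?_⟩
      rw [← norm_iteratedFDeriv_fderiv, hd]
      rw [show (-m : ℤ) = -m + -m + m by ring]
      exact hC x

end Symbols

section Operators

open scoped ContDiff SchwartzMap FourierTransform LineDeriv Laplacian
open SchwartzMap LineDeriv

set_option linter.unusedSectionVars false

variable {E : Type*} [NormedAddCommGroup E] [InnerProductSpace ℝ E] [FiniteDimensional ℝ E]
  [MeasurableSpace E] [BorelSpace E]

/-- Multiplication by the function `a`. -/
abbrev mulOp (a : E → ℂ) : 𝓢(E, ℂ) →L[ℂ] 𝓢(E, ℂ) := smulLeftCLM ℂ a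

/-- The Fourier multiplier with symbol `σ`. -/
abbrev fourierOp (σ : E → ℂ) : 𝓢(E, ℂ) →L[ℂ] 𝓢(E, ℂ) := fourierMultiplierCLM ℂ σ

/-- The derivative in the direction `v`. -/
abbrev derivOp (v : E) : 𝓢(E, ℂ) →L[ℂ] 𝓢(E, ℂ) := lineDerivOpCLM ℂ 𝓢(E, ℂ) v

/-- Multiplication by the linear coordinate `⟪x, v⟫`. -/
abbrev posOp (v : E) : 𝓢(E, ℂ) →L[ℂ] 𝓢(E, ℂ) := mulOp fun x => ((inner ℝ x v : ℝ) : ℂ)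

theorem hasTemperateGrowth_coord (v : E) :
    (fun x : E => ((inner ℝ x v : ℝ) : ℂ)).HasTemperateGrowth :=
  Function.HasTemperateGrowth.comp (g := Complex.ofReal) Function.Complex.hasTemperateGrowth_ofReal
    (by fun_prop)

theorem isSymbol_coord (v : E) : IsSymbol 1 (fun x : E => ((inner ℝ x v : ℝ) : ℂ)) := by
  have := ContinuousLinearMap.isSymbol (Complex.ofRealCLM ∘L (innerSL ℝ v))
  refine (congrArg _ ?_).mp this
  ext x
  simp [real_inner_comm]

theorem mulOp_mul {a b : E → ℂ} (ha : a.HasTemperateGrowth) (hb : b.HasTemperateGrowth) :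
    mulOp a * mulOp b = mulOp fun x => a x * b x := by
  ext f x
  simp only [mul_apply_eq_comp, mulOp, smulLeftCLM_smulLeftCLM_apply ha hb]
  rfl

theorem fourierOp_mul {a b : E → ℂ} (ha : a.HasTemperateGrowth) (hb : b.HasTemperateGrowth) :
    fourierOp a * fourierOp b = fourierOp fun x => a x * b x :=
  fourierMultiplierCLM_compL_fourierMultiplierCLM ha hb

theorem derivOp_mul_mulOp {m : ℤ} {a : E → ℂ} (ha : IsSymbol m a) (v : E) :
    derivOp v * mulOp a = mulOp a * derivOp v + mulOp fun x => fderiv ℝ a x v := by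
  ext f x
  have ha' := ha.hasTemperateGrowth
  have hd := (ha.fderiv_apply v).hasTemperateGrowth
  simp only [mul_apply_eq_comp, _root_.add_apply, mulOp, derivOp,
    lineDerivOpCLM_apply, smulLeftCLM_apply_apply ha', smulLeftCLM_apply_apply hd,
    lineDerivOp_apply_eq_fderiv]
  rw [show ⇑(smulLeftCLM ℂ a f) = fun x => a x * f x by
    ext x; simp [smulLeftCLM_apply_apply ha']]
  rw [fderiv_fun_mul (ha.contDiff.differentiable (by simp) x) f.differentiableAt]
  simp [mul_comm]

theorem derivOp_eq_fourierOp (v : E) :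
    derivOp v = fourierOp fun ξ => (2 * Real.pi * Complex.I) * ((inner ℝ ξ v : ℝ) : ℂ) := by
  ext1 f
  have h := fourierMultiplierCLM_smul (F := ℂ) (hasTemperateGrowth_coord v)
    (2 * Real.pi * Complex.I)
  simp only [derivOp, lineDerivOpCLM_apply, lineDeriv_eq_fourierMultiplierCLM]
  rw [← fourierMultiplierCLM_ofReal ℂ (by fun_prop)]
  exact (congrArg (fun T => T f) h).symm

theorem posOp_mul_fourierOp {m : ℤ} {σ : E → ℂ} (hσ : IsSymbol m σ) (v : E) :
    posOp v * fourierOp σ = fourierOp σ * posOp v +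
      (-(2 * Real.pi * Complex.I)⁻¹ : ℂ) • fourierOp fun ξ => fderiv ℝ σ ξ v := by
  ext1 f
  have hc : (2 * Real.pi * Complex.I : ℂ) ≠ 0 := Complex.two_pi_I_ne_zero
  have h1 : ∀ g : 𝓢(E, ℂ), posOp v (𝓕⁻ g) =
      (-(2 * Real.pi * Complex.I)⁻¹ : ℂ) • 𝓕⁻ (derivOp v g) := fun g => by
    simp only [derivOp, lineDerivOpCLM_apply]
    rw [fourierInv_lineDerivOp_eq, smul_smul, ← smulLeftCLM_ofReal ℂ (by fun_prop),
      neg_mul_neg, inv_mul_cancel₀ hc, one_smul]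
    rfl
  have h2 : derivOp v (𝓕 f) = (-(2 * Real.pi * Complex.I) : ℂ) • 𝓕 (posOp v f) := by
    simp only [derivOp, lineDerivOpCLM_apply]
    rw [lineDerivOp_fourier_eq, ← smulLeftCLM_ofReal ℂ (by fun_prop), FourierTransform.fourier_smul]
    rfl
  have h3 := congrArg (fun T => T (𝓕 f)) (derivOp_mul_mulOp hσ v)
  simp only [mul_apply_eq_comp, _root_.add_apply, h2] at h3
  simp only [mul_apply_eq_comp, _root_.add_apply,
    _root_.smul_apply, fourierOp, fourierMultiplierCLM_apply]
  rw [h1, h3, FourierTransform.fourierInv_add, map_smul, FourierTransform.fourierInv_smul,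
    smul_add, smul_smul, neg_mul_neg, inv_mul_cancel₀ hc, one_smul, add_comm]

theorem derivOp_mul_fourierOp {σ : E → ℂ} (hσ : σ.HasTemperateGrowth) (v : E) :
    derivOp v * fourierOp σ = fourierOp σ * derivOp v := by
  have : (fun ξ : E => (2 * Real.pi * Complex.I) * ((inner ℝ ξ v : ℝ) : ℂ)).HasTemperateGrowth :=
    (Function.HasTemperateGrowth.const (E := E) (2 * Real.pi * Complex.I : ℂ)).mul
      (hasTemperateGrowth_coord v)
  rw [derivOp_eq_fourierOp, fourierOp_mul this hσ, fourierOp_mul hσ this]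
  simp_rw [mul_comm]

/-- The `L²` norm of a Schwartz function. -/
abbrev normL2 (f : 𝓢(E, ℂ)) : ℝ := ‖f.toLp 2‖

variable (E) in
/-- The embedding of Schwartz functions into `L²`. -/
abbrev toL2 : 𝓢(E, ℂ) →L[ℂ] Lp ℂ 2 (volume : Measure E) := toLpCLM ℂ ℂ 2 volume

theorem normL2_eq (f : 𝓢(E, ℂ)) : normL2 f = ‖toL2 E f‖ := rfl

theorem normL2_add_le (f g : 𝓢(E, ℂ)) : normL2 (f + g) ≤ normL2 f + normL2 g := by
  simp only [normL2_eq, map_add]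
  exact norm_add_le _ _

theorem normL2_le_of_norm_le {f g : 𝓢(E, ℂ)} {C : ℝ} (h : ∀ x, ‖f x‖ ≤ C * ‖g x‖) :
    normL2 f ≤ C * normL2 g := by
  refine Lp.norm_le_mul_norm_of_ae_le_mul ?_
  filter_upwards [f.coeFn_toLp 2, g.coeFn_toLp 2] with x hf hg
  rw [hf, hg]; exact h x

theorem normL2_mulOp_le {a : E → ℂ} (ha : a.HasTemperateGrowth) {C : ℝ} (h : ∀ x, ‖a x‖ ≤ C)
    (f : 𝓢(E, ℂ)) : normL2 (mulOp a f) ≤ C * normL2 f :=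
  normL2_le_of_norm_le fun x => by
    rw [smulLeftCLM_apply_apply ha, norm_smul]; gcongr; exact h x

theorem normL2_fourierInv (f : 𝓢(E, ℂ)) : normL2 (𝓕⁻ f) = normL2 f := by
  conv_rhs => rw [← FourierTransform.fourier_fourierInv_eq (F := 𝓢(E, ℂ)) f]
  exact (norm_fourier_toL2_eq _).symm

theorem normL2_fourierOp_le {a : E → ℂ} (ha : a.HasTemperateGrowth) {C : ℝ} (h : ∀ x, ‖a x‖ ≤ C)
    (f : 𝓢(E, ℂ)) : normL2 (fourierOp a f) ≤ C * normL2 f := by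
  rw [fourierMultiplierCLM_apply, normL2_fourierInv, normL2, normL2, ← norm_fourier_toL2_eq f]
  exact normL2_mulOp_le ha h _

end Operators

section Gain

open scoped ContDiff SchwartzMap FourierTransform LineDeriv Laplacian
open SchwartzMap LineDeriv

set_option linter.unusedSectionVars false

variable {E : Type*} [NormedAddCommGroup E] [InnerProductSpace ℝ E] [FiniteDimensional ℝ E]
  [MeasurableSpace E] [BorelSpace E]

variable (E) in
/-- The algebra generated by multiplication operators and Fourier multipliers whose symbols are
bounded together with all their derivatives. -/
def symbolAlg : Subalgebra ℂ (𝓢(E, ℂ) →L[ℂ] 𝓢(E, ℂ)) :=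
  Algebra.adjoin ℂ {T | ∃ a : E → ℂ, IsSymbol 0 a ∧ (T = mulOp a ∨ T = fourierOp a)}

variable (E) in
/-- The directional derivatives and the multiplications by linear coordinates. -/
def weylGen : Set (𝓢(E, ℂ) →L[ℂ] 𝓢(E, ℂ)) := {X | ∃ v : E, X = derivOp v ∨ X = posOp v}

theorem mulOp_mem_symbolAlg {a : E → ℂ} (ha : IsSymbol 0 a) : mulOp a ∈ symbolAlg E :=
  Algebra.subset_adjoin ⟨a, ha, .inl rfl⟩

theorem fourierOp_mem_symbolAlg {a : E → ℂ} (ha : IsSymbol 0 a) : fourierOp a ∈ symbolAlg E :=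
  Algebra.subset_adjoin ⟨a, ha, .inr rfl⟩

theorem commutator_mem_symbolAlg {X T : 𝓢(E, ℂ) →L[ℂ] 𝓢(E, ℂ)} (hX : X ∈ weylGen E)
    (hT : T ∈ symbolAlg E) : X * T - T * X ∈ symbolAlg E := by
  induction hT using Algebra.adjoin_induction with
  | mem T hT =>
    obtain ⟨a, ha, rfl | rfl⟩ := hT <;> obtain ⟨v, rfl | rfl⟩ := hX
    · rw [derivOp_mul_mulOp ha, add_sub_cancel_left]
      exact mulOp_mem_symbolAlg (ha.fderiv_apply v)
    · rw [mulOp_mul (hasTemperateGrowth_coord v) ha.hasTemperateGrowth,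
        mulOp_mul ha.hasTemperateGrowth (hasTemperateGrowth_coord v)]
      simp_rw [mul_comm]
      simp
    · rw [derivOp_mul_fourierOp ha.hasTemperateGrowth, sub_self]
      exact zero_mem _
    · rw [posOp_mul_fourierOp ha, add_sub_cancel_left]
      exact Subalgebra.smul_mem _ (fourierOp_mem_symbolAlg (ha.fderiv_apply v)) _
  | algebraMap r => simp [Algebra.commutes r X]
  | add S T _ _ hS hT =>
    convert add_mem hS hT using 1
    noncomm_ring
  | mul S T hS' hT' hS hT =>
    convert add_mem (mul_mem hS hT') (mul_mem hS' hT) using 1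
    noncomm_ring

theorem symbolAlg.bounded {T : 𝓢(E, ℂ) →L[ℂ] 𝓢(E, ℂ)} (hT : T ∈ symbolAlg E) :
    ∃ C, 0 ≤ C ∧ ∀ f, normL2 (T f) ≤ C * normL2 f := by
  induction hT using Algebra.adjoin_induction with
  | mem T hT =>
    obtain ⟨a, ha, h⟩ := hT
    obtain ⟨C, hC⟩ := ha.norm_le
    simp only [zpow_zero, mul_one] at hC
    refine ⟨C, (norm_nonneg _).trans (hC 0), ?_⟩
    obtain rfl | rfl := h
    · exact normL2_mulOp_le ha.hasTemperateGrowth hC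
    · exact normL2_fourierOp_le ha.hasTemperateGrowth hC
  | algebraMap r =>
    refine ⟨‖r‖, norm_nonneg _, fun f => normL2_le_of_norm_le fun x => ?_⟩
    simp [Algebra.algebraMap_eq_smul_one]
  | add S T _ _ hS hT =>
    obtain ⟨C, hC, h⟩ := hS
    obtain ⟨D, hD, h'⟩ := hT
    refine ⟨C + D, by positivity, fun f => ?_⟩
    rw [add_mul]
    exact (normL2_add_le _ _).trans (add_le_add (h f) (h' f))
  | mul S T _ _ hS hT =>
    obtain ⟨C, hC, h⟩ := hS
    obtain ⟨D, hD, h'⟩ := hT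
    refine ⟨C * D, by positivity, fun f => ?_⟩
    rw [mul_assoc]
    exact (h (T f)).trans (mul_le_mul_of_nonneg_left (h' f) hC)

variable (E) in
/-- Operators which stay in `symbolAlg E` after composition on the left with at most `k`
elements of `weylGen E`. -/
def gain : ℕ → Submodule ℂ (𝓢(E, ℂ) →L[ℂ] 𝓢(E, ℂ))
  | 0 => Subalgebra.toSubmodule (symbolAlg E)
  | k + 1 =>
    { carrier := {T | T ∈ gain k ∧ ∀ X ∈ weylGen E, X * T ∈ gain k}
      add_mem' := fun hS hT => ⟨add_mem hS.1 hT.1, fun X hX => by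
        rw [mul_add]; exact add_mem (hS.2 X hX) (hT.2 X hX)⟩
      zero_mem' := ⟨zero_mem _, fun X _ => by rw [mul_zero]; exact zero_mem _⟩
      smul_mem' := fun c T hT => ⟨Submodule.smul_mem _ c hT.1, fun X hX => by
        rw [mul_smul_comm]; exact Submodule.smul_mem _ c (hT.2 X hX)⟩ }

theorem gain_anti {k l : ℕ} (h : k ≤ l) : gain E l ≤ gain E k := by
  induction h with
  | refl => exact le_rfl
  | step _ ih => exact fun T hT => ih hT.1

theorem mul_mem_gain {k : ℕ} {A T : 𝓢(E, ℂ) →L[ℂ] 𝓢(E, ℂ)} (hA : A ∈ symbolAlg E)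
    (hT : T ∈ gain E k) : A * T ∈ gain E k := by
  induction k generalizing A T with
  | zero => exact (symbolAlg E).mul_mem hA hT
  | succ k ih =>
    refine ⟨ih hA hT.1, fun X hX => ?_⟩
    have h1 := ih hA (hT.2 X hX)
    have h2 := ih (commutator_mem_symbolAlg hX hA) hT.1
    convert add_mem h1 h2 using 1
    noncomm_ring

theorem mul_mem_gain_succ {k : ℕ} {A T : 𝓢(E, ℂ) →L[ℂ] 𝓢(E, ℂ)} (hA : A ∈ gain E 1)
    (hT : T ∈ gain E k) : A * T ∈ gain E (k + 1) :=
  ⟨mul_mem_gain hA.1 hT, fun X hX => by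
    rw [← mul_assoc]; exact mul_mem_gain (hA.2 X hX) hT⟩

theorem pow_mem_gain {A : 𝓢(E, ℂ) →L[ℂ] 𝓢(E, ℂ)} (hA : A ∈ gain E 1) (k : ℕ) :
    A ^ k ∈ gain E k := by
  induction k with
  | zero => exact one_mem (symbolAlg E)
  | succ k ih => rw [pow_succ']; exact mul_mem_gain_succ hA ih

theorem fourierOp_mul_mulOp_mem_gain {σ a : E → ℂ} (hσ : IsSymbol (-1) σ) (ha : IsSymbol (-1) a) :
    fourierOp σ * mulOp a ∈ gain E 1 := by
  have hσ0 := hσ.mono (m' := 0) (by norm_num)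
  have ha0 := ha.mono (m' := 0) (by norm_num)
  refine ⟨(symbolAlg E).mul_mem (fourierOp_mem_symbolAlg hσ0) (mulOp_mem_symbolAlg ha0), ?_⟩
  rintro _ ⟨v, rfl | rfl⟩
  · rw [← mul_assoc, derivOp_eq_fourierOp, fourierOp_mul _ hσ.hasTemperateGrowth]
    · refine (symbolAlg E).mul_mem (fourierOp_mem_symbolAlg ?_) (mulOp_mem_symbolAlg ha0)
      simpa using! ((isSymbol_coord v).const_mul (2 * Real.pi * Complex.I)).mul hσ
    · exact ((isSymbol_coord v).const_mul (2 * Real.pi * Complex.I)).hasTemperateGrowth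
  · rw [← mul_assoc, posOp_mul_fourierOp hσ, add_mul, mul_assoc,
      mulOp_mul (hasTemperateGrowth_coord v) ha.hasTemperateGrowth, smul_mul_assoc]
    refine add_mem ((symbolAlg E).mul_mem (fourierOp_mem_symbolAlg hσ0) (mulOp_mem_symbolAlg ?_))
      (Subalgebra.smul_mem _ ((symbolAlg E).mul_mem (fourierOp_mem_symbolAlg (hσ0.fderiv_apply v))
        (mulOp_mem_symbolAlg ha0)) _)
    simpa using! (isSymbol_coord v).mul ha

end Gain

section SeminormBounds

open scoped ContDiff SchwartzMap FourierTransform LineDeriv Laplacian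
open SchwartzMap LineDeriv

set_option linter.unusedSectionVars false

variable {E : Type*} [NormedAddCommGroup E] [InnerProductSpace ℝ E] [FiniteDimensional ℝ E]
  [MeasurableSpace E] [BorelSpace E]

variable (E) in
/-- The Fourier multiplier with symbol `1 + ‖ξ‖ ^ 2`. -/
def besselOp : 𝓢(E, ℂ) →L[ℂ] 𝓢(E, ℂ) := fourierOp fun ξ => ((1 + ‖ξ‖ ^ 2 : ℝ) : ℂ)

theorem hasTemperateGrowth_one_add_norm_sq_pow (M : ℕ) :
    (fun ξ : E => ((1 + ‖ξ‖ ^ 2 : ℝ) : ℂ) ^ M).HasTemperateGrowth :=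
  (Function.HasTemperateGrowth.comp (g := Complex.ofReal)
    Function.Complex.hasTemperateGrowth_ofReal (by fun_prop)).pow M

theorem besselOp_pow (M : ℕ) :
    besselOp E ^ M = fourierOp fun ξ => ((1 + ‖ξ‖ ^ 2 : ℝ) : ℂ) ^ M := by
  induction M with
  | zero =>
    ext1 f
    simp [fourierMultiplierCLM_const]
  | succ M ih =>
    rw [pow_succ, ih, besselOp, fourierOp_mul (hasTemperateGrowth_one_add_norm_sq_pow M)]
    · simp_rw [← pow_succ]
    · simpa using hasTemperateGrowth_one_add_norm_sq_pow (E := E) 1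

theorem besselOp_eq : besselOp E =
    1 + ∑ i, (-(2 * Real.pi * Complex.I)⁻¹ ^ 2 * -1 : ℂ) •
      (derivOp (stdOrthonormalBasis ℝ E i) * derivOp (stdOrthonormalBasis ℝ E i)) := by
  have hc : (2 * Real.pi * Complex.I : ℂ) ≠ 0 := Complex.two_pi_I_ne_zero
  have h1 : ∀ v : E, ((2 * Real.pi * Complex.I)⁻¹ ^ 2 : ℂ) • (derivOp v * derivOp v) =
      fourierOp fun ξ => ((inner ℝ ξ v : ℝ) : ℂ) ^ 2 := fun v => by
    have h2 := (isSymbol_coord v).const_mul (2 * Real.pi * Complex.I)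
    rw [derivOp_eq_fourierOp, fourierOp_mul h2.hasTemperateGrowth h2.hasTemperateGrowth,
      fourierOp, ← fourierMultiplierCLM_smul (h2.mul h2).hasTemperateGrowth]
    congr 1
    ext ξ
    simp only [Pi.smul_apply, smul_eq_mul]
    field_simp
  simp only [mul_neg, mul_one, neg_neg, h1]
  have h3 : ∀ v : E, (fun ξ : E => ((inner ℝ ξ v : ℝ) : ℂ) ^ 2).HasTemperateGrowth :=
    fun v => (hasTemperateGrowth_coord v).pow 2
  rw [besselOp, ← fourierMultiplierCLM_sum ℂ fun i _ => h3 _]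
  ext1 f
  simp only [_root_.add_apply, one_apply_eq_self, fourierOp, fourierMultiplierCLM_apply]
  rw [← FourierTransform.fourierInv_fourier_eq (F := 𝓢(E, ℂ)) f]
  simp only [FourierTransform.fourier_fourierInv_eq, ← FourierTransform.fourierInv_add]
  congr 1
  ext ξ
  rw [smulLeftCLM_apply_apply (by simpa using hasTemperateGrowth_one_add_norm_sq_pow (E := E) 1),
    _root_.add_apply,
    smulLeftCLM_apply_apply (Function.HasTemperateGrowth.sum fun i _ => h3 _)]
  rw [← (stdOrthonormalBasis ℝ E).sum_sq_inner_left]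
  push_cast
  simp only [smul_eq_mul]
  ring

theorem besselOp_mul_mem_gain {k : ℕ} {T : 𝓢(E, ℂ) →L[ℂ] 𝓢(E, ℂ)} (hT : T ∈ gain E (k + 2)) :
    besselOp E * T ∈ gain E k := by
  rw [besselOp_eq, add_mul, one_mul, Finset.sum_mul]
  refine add_mem (gain_anti (by omega) hT) (sum_mem fun i _ => ?_)
  rw [smul_mul_assoc, mul_assoc]
  exact Submodule.smul_mem _ _ ((hT.2 _ ⟨_, .inl rfl⟩).2 _ ⟨_, .inl rfl⟩)

theorem besselOp_pow_mul_mem_gain {k M : ℕ} {T : 𝓢(E, ℂ) →L[ℂ] 𝓢(E, ℂ)}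
    (hT : T ∈ gain E (k + 2 * M)) : besselOp E ^ M * T ∈ gain E k := by
  induction M generalizing T with
  | zero => simpa using hT
  | succ M ih =>
    rw [pow_succ, mul_assoc]
    exact ih (besselOp_mul_mem_gain hT)

theorem norm_apply_le_integral_fourier (h : 𝓢(E, ℂ)) (x : E) : ‖h x‖ ≤ ∫ ξ, ‖𝓕 h ξ‖ := by
  have h1 := norm_fourier_apply_le_toLp_one (𝓕 h) (-x)
  rw [norm_toLp_one] at h1
  have h2 : h x = 𝓕⁻ (𝓕 h) x := by rw [FourierTransform.fourierInv_fourier_eq]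
  rwa [h2, fourierInv_coe, Real.fourierInv_eq_fourier_neg, ← fourier_coe]

variable (E) in
theorem exists_norm_apply_le_besselOp_pow :
    ∃ M C, 0 ≤ C ∧ ∀ (h : 𝓢(E, ℂ)) x, ‖h x‖ ≤ C * normL2 ((besselOp E ^ M) h) := by
  let M := Module.finrank ℝ E + 1
  let s : E → ℝ := fun ξ => ((1 + ‖ξ‖ ^ 2) ^ M)⁻¹
  have hpos : ∀ ξ : E, 0 < 1 + ‖ξ‖ ^ 2 := fun ξ => by positivity
  have hs : MemLp s 2 volume := by
    have hc : Continuous s := by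
      refine Continuous.inv₀ (by fun_prop) fun ξ => (pow_pos (hpos ξ) _).ne'
    rw [memLp_two_iff_integrable_sq hc.aestronglyMeasurable]
    have := integrable_rpow_neg_one_add_norm_sq (E := E) (μ := volume) (r := 4 * M)
      (by simp only [M]; push_cast; linarith [(Module.finrank ℝ E).cast_nonneg (α := ℝ)])
    refine this.congr (.of_forall fun ξ => ?_)
    simp only [s]
    rw [← inv_pow, ← pow_mul, show -(4 * (M : ℝ)) / 2 = -((M * 2 : ℕ) : ℝ) by push_cast; ring,
      Real.rpow_neg (hpos ξ).le, Real.rpow_natCast, inv_pow]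
  refine ⟨M, (∫ ξ, s ξ ^ (2 : ℝ)) ^ (1 / (2 : ℝ)), by positivity, fun h x => ?_⟩
  refine (norm_apply_le_integral_fourier h x).trans ?_
  set g := 𝓕 ((besselOp E ^ M) h)
  have h1 : ∀ ξ, ‖𝓕 h ξ‖ = s ξ * ‖g ξ‖ := fun ξ => by
    have h2 : g = smulLeftCLM ℂ (fun ξ : E => ((1 + ‖ξ‖ ^ 2 : ℝ) : ℂ) ^ M) (𝓕 h) := by
      simp only [g]
      rw [besselOp_pow, fourierMultiplierCLM_apply, FourierTransform.fourier_fourierInv_eq]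
    rw [h2, smulLeftCLM_apply_apply (hasTemperateGrowth_one_add_norm_sq_pow M), norm_smul,
      norm_pow, Complex.norm_real, Real.norm_of_nonneg (hpos ξ).le, ← mul_assoc,
      inv_mul_cancel₀ (pow_pos (hpos ξ) _).ne', one_mul]
  simp_rw [h1]
  have h3 := integral_mul_le_Lp_mul_Lq_of_nonneg (μ := (volume : Measure E))
    Real.HolderConjugate.two_two (f := s) (g := fun ξ => ‖g ξ‖)
    (.of_forall fun ξ => by simp only [Pi.zero_apply, s]; positivity)
    (.of_forall fun ξ => norm_nonneg _) (by simpa using hs) (by simpa using (g.memLp 2).norm)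
  refine h3.trans_eq ?_
  rw [normL2, ← norm_fourier_toL2_eq, norm_toLp' (by simp) (by simp)]
  simp [g]

theorem seminorm_succ_zero_le (k : ℕ) (h : 𝓢(E, ℂ)) : SchwartzMap.seminorm ℂ (k + 1) 0 h ≤
    ∑ i, SchwartzMap.seminorm ℂ k 0 (posOp (stdOrthonormalBasis ℝ E i) h) := by
  refine seminorm_le_bound ℂ _ _ _ (Finset.sum_nonneg fun i _ => apply_nonneg _ _) fun x => ?_
  have h1 : ‖x‖ ≤ ∑ i, |inner ℝ x (stdOrthonormalBasis ℝ E i)| := by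
    conv_lhs => rw [← (stdOrthonormalBasis ℝ E).sum_repr' x]
    refine (norm_sum_le _ _).trans (Finset.sum_le_sum fun i _ => ?_)
    rw [norm_smul, (stdOrthonormalBasis ℝ E).norm_eq_one, mul_one, real_inner_comm,
      Real.norm_eq_abs]
  rw [norm_iteratedFDeriv_zero]
  calc _ = ‖x‖ * (‖x‖ ^ k * ‖h x‖) := by ring
    _ ≤ (∑ i, |inner ℝ x (stdOrthonormalBasis ℝ E i)|) * (‖x‖ ^ k * ‖h x‖) := by gcongr
    _ ≤ _ := by
      rw [Finset.sum_mul]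
      refine Finset.sum_le_sum fun i _ => ?_
      refine le_trans (le_of_eq ?_) (norm_pow_mul_le_seminorm ℂ _ k x)
      rw [smulLeftCLM_apply_apply (hasTemperateGrowth_coord _), norm_smul, Complex.norm_real,
        Real.norm_eq_abs]
      ring

variable (E) in
theorem exists_seminorm_succ_le : ∃ C : ℝ, 0 ≤ C ∧ ∀ (k n : ℕ) (h : 𝓢(E, ℂ)),
    SchwartzMap.seminorm ℂ k (n + 1) h ≤
      ∑ i, C * SchwartzMap.seminorm ℂ k n (derivOp (stdOrthonormalBasis ℝ E i) h) := by
  let b := stdOrthonormalBasis ℝ E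
  let ℓ := fun i => ContinuousLinearMap.smulRightL ℝ E ℂ (innerSL ℝ (b i))
  refine ⟨∑ i, ‖ℓ i‖, by positivity, fun k n h => ?_⟩
  refine seminorm_le_bound ℂ _ _ _ (Finset.sum_nonneg fun i _ => by positivity) fun x => ?_
  have h1 : fderiv ℝ h = fun x => ∑ i, ℓ i (derivOp (b i) h x) := by
    ext x v
    conv_lhs => rw [← b.sum_repr' v]
    simp [ℓ, lineDerivOp_apply_eq_fderiv]
  rw [← norm_iteratedFDeriv_fderiv, h1, iteratedFDeriv_fun_sum_apply]
  · refine (mul_le_mul_of_nonneg_left (norm_sum_le _ _) (by positivity)).trans ?_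
    rw [Finset.mul_sum]
    refine Finset.sum_le_sum fun i _ => ?_
    have h2 : ‖ℓ i‖ ≤ ∑ i, ‖ℓ i‖ :=
      Finset.single_le_sum (f := fun i => ‖ℓ i‖) (fun i _ => norm_nonneg (ℓ i)) (Finset.mem_univ i)
    have h3 := (ℓ i).norm_iteratedFDeriv_comp_left (n := n)
      ((derivOp (b i) h).contDiffAt ⊤ (x := x)) (by exact_mod_cast le_top)
    calc _ ≤ ‖x‖ ^ k * (‖ℓ i‖ * ‖iteratedFDeriv ℝ n (derivOp (b i) h) x‖) := by gcongr; exact h3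
      _ = ‖ℓ i‖ * (‖x‖ ^ k * ‖iteratedFDeriv ℝ n (derivOp (b i) h) x‖) := by ring
      _ ≤ _ := mul_le_mul h2 (le_seminorm ℂ k n _ x) (by positivity) (by positivity)
  · exact fun i _ => ((ℓ i).contDiff.comp ((derivOp (b i) h).smooth n)).contDiffAt

theorem exists_seminorm_le_of_mem_gain (k n : ℕ) : ∃ j, ∀ T ∈ gain E j, ∃ C, 0 ≤ C ∧ ∀ g,
    SchwartzMap.seminorm ℂ k n (T g) ≤ C * normL2 g := by
  induction n generalizing k with
  | zero =>
    induction k with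
    | zero =>
      obtain ⟨M, C, hC, h⟩ := exists_norm_apply_le_besselOp_pow E
      refine ⟨2 * M, fun T hT => ?_⟩
      have h1 : besselOp E ^ M * T ∈ gain E 0 := besselOp_pow_mul_mem_gain (by simpa using hT)
      obtain ⟨D, hD, h2⟩ := symbolAlg.bounded h1
      refine ⟨C * D, by positivity, fun g => ?_⟩
      refine seminorm_le_bound ℂ _ _ _ (by positivity) fun x => ?_
      simp only [pow_zero, one_mul, norm_iteratedFDeriv_zero]
      rw [mul_assoc]
      exact (h (T g) x).trans (mul_le_mul_of_nonneg_left (h2 g) hC)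
    | succ k ih =>
      obtain ⟨j, hj⟩ := ih
      refine ⟨j + 1, fun T hT => ?_⟩
      choose C hC h using fun i => hj _ (hT.2 (posOp (stdOrthonormalBasis ℝ E i)) ⟨_, .inr rfl⟩)
      refine ⟨∑ i, C i, Finset.sum_nonneg fun i _ => hC i, fun g => ?_⟩
      rw [Finset.sum_mul]
      exact (seminorm_succ_zero_le k (T g)).trans (Finset.sum_le_sum fun i _ => h i g)
  | succ n ih =>
    obtain ⟨j, hj⟩ := ih k
    obtain ⟨D, hD, hs⟩ := exists_seminorm_succ_le E
    refine ⟨j + 1, fun T hT => ?_⟩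
    choose C hC h using fun i => hj _ (hT.2 (derivOp (stdOrthonormalBasis ℝ E i)) ⟨_, .inl rfl⟩)
    refine ⟨∑ i, D * C i, Finset.sum_nonneg fun i _ => mul_nonneg hD (hC i), fun g => ?_⟩
    rw [Finset.sum_mul]
    refine (hs k n (T g)).trans (Finset.sum_le_sum fun i _ => ?_)
    rw [mul_assoc]
    exact mul_le_mul_of_nonneg_left (h i g) hD

end SeminormBounds

section Completeness

open scoped ContDiff SchwartzMap Topology
open SchwartzMap Filter

variable {E F : Type*} [NormedAddCommGroup E] [NormedSpace ℝ E] [NormedAddCommGroup F]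
  [NormedSpace ℝ F] [CompleteSpace F]

theorem SchwartzMap.exists_hasSum_of_summable_seminorm (f : ℕ → 𝓢(E, F))
    (hf : ∀ k n, Summable fun j => SchwartzMap.seminorm ℝ k n (f j)) :
    ∃ G : 𝓢(E, F), Tendsto (fun J => ∑ j ∈ Finset.range J, f j) atTop (𝓝 G) := by
  have hb : ∀ n j x, ‖iteratedFDeriv ℝ n (f j) x‖ ≤ SchwartzMap.seminorm ℝ 0 n (f j) :=
    fun n j x => norm_iteratedFDeriv_le_seminorm ℝ (f j) n x
  have hsm : ContDiff ℝ ∞ fun x => ∑' j, f j x :=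
    contDiff_tsum (fun j => (f j).smooth ⊤) (fun n _ => hf 0 n) (fun n j x _ => hb n j x)
  have hder : ∀ n x, iteratedFDeriv ℝ n (fun x => ∑' j, f j x) x =
      ∑' j, iteratedFDeriv ℝ n (f j) x := fun n x =>
    iteratedFDeriv_tsum_apply (N := ⊤) (fun j => (f j).smooth ⊤) (fun n _ => hf 0 n)
      (fun n j x _ => hb n j x) le_top x
  have hsum : ∀ n x, Summable fun j => iteratedFDeriv ℝ n (f j) x := fun n x =>
    .of_norm_bounded (hf 0 n) fun j => hb n j x
  have htail : ∀ k n J x, ‖x‖ ^ k * ‖∑' j, iteratedFDeriv ℝ n (f (j + J)) x‖ ≤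
      ∑' j, SchwartzMap.seminorm ℝ k n (f (j + J)) := fun k n J x => by
    have hs : Summable fun j => SchwartzMap.seminorm ℝ k n (f (j + J)) :=
      (summable_nat_add_iff J).2 (hf k n)
    rw [← Real.norm_of_nonneg (pow_nonneg (norm_nonneg x) k), ← norm_smul,
      ← ((summable_nat_add_iff J).2 (hsum n x)).tsum_const_smul]
    refine tsum_of_norm_bounded hs.hasSum fun j => ?_
    rw [norm_smul, Real.norm_of_nonneg (pow_nonneg (norm_nonneg x) k)]
    exact le_seminorm ℝ k n _ x
  let G : 𝓢(E, F) := ⟨fun x => ∑' j, f j x, hsm, fun k n => ⟨_, fun x => by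
    rw [hder]; exact htail k n 0 x⟩⟩
  refine ⟨G, ((schwartz_withSeminorms ℝ E F).tendsto_nhds _ _).2 fun ⟨k, n⟩ ε hε => ?_⟩
  have key : ∀ J, SchwartzMap.seminorm ℝ k n ((∑ j ∈ Finset.range J, f j) - G) ≤
      ∑' j, SchwartzMap.seminorm ℝ k n (f (j + J)) := fun J => by
    refine seminorm_le_bound ℝ k n _ (tsum_nonneg fun j => apply_nonneg _ _) fun x => ?_
    refine le_trans (le_of_eq ?_) (htail k n J x)
    have h1 : iteratedFDeriv ℝ n ((∑ j ∈ Finset.range J, f j : 𝓢(E, F)) : E → F) x =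
        ∑ j ∈ Finset.range J, iteratedFDeriv ℝ n (f j) x := by
      rw [← iteratedFDeriv_fun_sum_apply fun j _ => ((f j).smooth n).contDiffAt]
      congr 1
      ext y; simp
    have h2 : iteratedFDeriv ℝ n (((∑ j ∈ Finset.range J, f j) - G : 𝓢(E, F)) : E → F) x =
        - ∑' j, iteratedFDeriv ℝ n (f (j + J)) x := by
      rw [show (((∑ j ∈ Finset.range J, f j) - G : 𝓢(E, F)) : E → F) =
          ⇑(∑ j ∈ Finset.range J, f j : 𝓢(E, F)) + -⇑G by ext y; simp [sub_eq_add_neg],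
        iteratedFDeriv_add_apply ((SchwartzMap.smooth _ n).contDiffAt)
          (show ContDiff ℝ n (-⇑G) from (G.smooth n).neg).contDiffAt, iteratedFDeriv_neg_apply, h1,
        show iteratedFDeriv ℝ n (⇑G) x = _ from hder n x,
        ← (hsum n x).sum_add_tsum_nat_add J]
      abel
    rw [h2, norm_neg]
  filter_upwards [(tendsto_sum_nat_add fun j => SchwartzMap.seminorm ℝ k n (f j)).eventually_lt_const
    hε] with J hJ using (key J).trans_lt hJ

theorem SchwartzMap.exists_tendsto_of_seminorm_sub_le (g : ℕ → 𝓢(E, F))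
    (hg : ∀ k n, ∀ᶠ j in atTop, SchwartzMap.seminorm ℝ k n (g (j + 1) - g j) ≤ (1 / 2) ^ j) :
    ∃ G : 𝓢(E, F), Tendsto g atTop (𝓝 G) := by
  obtain ⟨G, hG⟩ := SchwartzMap.exists_hasSum_of_summable_seminorm (fun j => g (j + 1) - g j)
    fun k n => by
      refine summable_of_isBigO_nat summable_geometric_two (Asymptotics.IsBigO.of_bound 1 ?_)
      filter_upwards [hg k n] with j hj
      rw [Real.norm_of_nonneg (apply_nonneg _ _), Real.norm_of_nonneg (by positivity), one_mul]
      exact hj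
  refine ⟨G + g 0, ?_⟩
  simp only [Finset.sum_range_sub] at hG
  simpa only [sub_add_cancel] using hG.add_const (g 0)

end Completeness

section Regularity

open scoped ContDiff SchwartzMap Topology
open SchwartzMap Filter

set_option linter.unusedSectionVars false

variable {E : Type*} [NormedAddCommGroup E] [InnerProductSpace ℝ E] [FiniteDimensional ℝ E]
  [MeasurableSpace E] [BorelSpace E]

theorem denseRange_toL2 : DenseRange (toL2 E) := denseRange_toLpCLM (by simp)

theorem norm_le_of_inner_toL2_le {z : Lp ℂ 2 (volume : Measure E)} {c : ℝ} (hc : 0 ≤ c)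
    (h : ∀ ψ, ‖inner ℂ z (toL2 E ψ)‖ ≤ c * ‖toL2 E ψ‖) : ‖z‖ ≤ c := by
  have h1 : ∀ y, ‖inner ℂ z y‖ ≤ c * ‖y‖ := fun y =>
    denseRange_toL2.induction_on (p := fun y => ‖inner ℂ z y‖ ≤ c * ‖y‖) y
      (isClosed_le (by fun_prop) (by fun_prop)) h
  have h2 := h1 z
  rw [inner_self_eq_norm_sq_to_K] at h2
  simp only [norm_pow, RCLike.norm_ofReal, abs_norm] at h2
  rcases (norm_nonneg z).eq_or_lt with h0 | h0
  · rw [← h0]; exact hc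
  · nlinarith

theorem exists_toL2_eq_of_mem_gain {A B : 𝓢(E, ℂ) →L[ℂ] 𝓢(E, ℂ)} (hA : A ∈ gain E 1)
    (hAB : ∀ f g, inner ℂ (toL2 E (A f)) (toL2 E g) = inner ℂ (toL2 E f) (toL2 E (B g)))
    {u : Lp ℂ 2 (volume : Measure E)}
    (hu : ∀ ψ, inner ℂ u (toL2 E ψ) = inner ℂ u (toL2 E (B ψ))) : ∃ g, toL2 E g = u := by
  obtain ⟨C, hC, hAC⟩ : ∃ C, 1 ≤ C ∧ ∀ f, normL2 (A f) ≤ C * normL2 f := by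
    obtain ⟨C, hC, h⟩ := symbolAlg.bounded hA.1
    exact ⟨C + 1, by linarith, fun f => (h f).trans (by gcongr; linarith)⟩
  have hBC : ∀ f, normL2 (B f) ≤ C * normL2 f := fun f => by
    have h1 := norm_inner_le_norm (𝕜 := ℂ) (toL2 E (A (B f))) (toL2 E f)
    rw [hAB, inner_self_eq_norm_sq_to_K] at h1
    simp only [norm_pow, RCLike.norm_ofReal, abs_norm] at h1
    have h2 := hAC (B f)
    simp only [normL2_eq] at h2 ⊢
    rcases (norm_nonneg (toL2 E (B f))).eq_or_lt with h0 | h0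
    · rw [← h0]; positivity
    · nlinarith [norm_nonneg (toL2 E f)]
  have hstep : ∀ f, ‖toL2 E (A f) - u‖ ≤ C * ‖toL2 E f - u‖ := fun f => by
    refine norm_le_of_inner_toL2_le
      (mul_nonneg (by linarith) (norm_nonneg _)) fun ψ => ?_
    have h1 : inner ℂ (toL2 E (A f) - u) (toL2 E ψ) =
        inner ℂ (toL2 E f - u) (toL2 E (B ψ)) := by
      rw [inner_sub_left, inner_sub_left, hAB, hu]
    rw [h1]
    refine (norm_inner_le_norm _ _).trans ?_
    have := mul_le_mul_of_nonneg_left (hBC ψ) (norm_nonneg (toL2 E f - u))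
    simp only [normL2_eq] at this
    linarith
  have hpow : ∀ n f, ‖toL2 E ((A ^ n) f) - u‖ ≤ C ^ n * ‖toL2 E f - u‖ := fun n => by
    induction n with
    | zero => simp
    | succ n ih =>
      intro f
      rw [pow_succ', pow_succ', mul_assoc]
      exact (hstep _).trans (mul_le_mul_of_nonneg_left (ih f) (by linarith))
  choose J hJ using exists_seminorm_le_of_mem_gain (E := E)
  have hc : ∀ k n j, ∃ c, 0 ≤ c ∧ (J k n ≤ j → ∀ g,
      SchwartzMap.seminorm ℂ k n ((A ^ j) g) ≤ c * normL2 g) := fun k n j => by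
    by_cases hj : J k n ≤ j
    · obtain ⟨c, hc, h⟩ := hJ k n _ (gain_anti hj (pow_mem_gain hA j))
      exact ⟨c, hc, fun _ => h⟩
    · exact ⟨0, le_rfl, fun h => absurd h hj⟩
  choose c hc0 hc using hc
  let b : ℕ → ℝ := fun j => 1 + ∑ k ∈ Finset.range (j + 1), ∑ n ∈ Finset.range (j + 1), c k n j
  have hb0 : ∀ j, 0 < b j := fun j =>
    add_pos_of_pos_of_nonneg one_pos
      (Finset.sum_nonneg fun k _ => Finset.sum_nonneg fun n _ => hc0 k n j)
  have hb : ∀ k n j, k ≤ j → n ≤ j → c k n j ≤ b j := fun k n j hk hn => by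
    have h1 := Finset.single_le_sum (f := fun n => c k n j) (fun n _ => hc0 k n j)
      (Finset.mem_range_succ_iff.2 hn)
    have h2 := Finset.single_le_sum (f := fun k => ∑ n ∈ Finset.range (j + 1), c k n j)
      (fun k _ => Finset.sum_nonneg fun n _ => hc0 k n j) (Finset.mem_range_succ_iff.2 hk)
    simp only [b]
    linarith
  let ε : ℕ → ℝ := fun j => (1 / 2) ^ j / (2 * b j)
  have hε : ∀ j, 0 < ε j := fun j => by have := hb0 j; positivity
  let δ : ℕ → ℝ := fun j => min (min (ε j) (ε (j - 1))) ((1 / 2) ^ j) / C ^ (j + 1)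
  have hδ : ∀ j, 0 < δ j := fun j =>
    div_pos (lt_min (lt_min (hε _) (hε _)) (by positivity)) (by positivity)
  have hδm : ∀ j, C ^ (j + 1) * δ j = min (min (ε j) (ε (j - 1))) ((1 / 2) ^ j) := fun j => by
    simp only [δ]; field_simp
  have hex : ∀ j, ∃ f, ‖toL2 E f - u‖ < δ j := fun j => by
    obtain ⟨f, hf⟩ := denseRange_toL2.exists_dist_lt u (hδ j)
    exact ⟨f, by rwa [dist_comm, dist_eq_norm] at hf⟩
  choose f hf using hex
  have hle : ∀ j i, i ≤ j + 1 → C ^ i * ‖toL2 E (f j) - u‖ ≤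
      min (min (ε j) (ε (j - 1))) ((1 / 2) ^ j) := fun j i hi => by
    rw [← hδm]
    exact mul_le_mul (pow_le_pow_right₀ hC hi) (hf j).le (norm_nonneg _) (by positivity)
  have hdiff : ∀ j, normL2 (A (f (j + 1)) - f j) ≤ (1 / 2) ^ j / b j := fun j => by
    have h1 := hle j 0 (by omega)
    have h2 := hle (j + 1) 1 (by omega)
    simp only [pow_zero, one_mul, pow_one, le_min_iff, Nat.add_sub_cancel] at h1 h2
    have h3 : toL2 E (A (f (j + 1)) - f j) =
        (toL2 E (A (f (j + 1))) - u) - (toL2 E (f j) - u) := by rw [map_sub]; abel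
    rw [normL2_eq, h3]
    refine (norm_sub_le _ _).trans ((add_le_add ((hstep _).trans h2.1.2) h1.1.1).trans_eq ?_)
    simp only [ε]
    field_simp
    norm_num
  obtain ⟨G, hG⟩ := SchwartzMap.exists_tendsto_of_seminorm_sub_le (fun j => (A ^ j) (f j))
    fun k n => by
      filter_upwards [eventually_ge_atTop (max (max k n) (J k n))] with j hj
      simp only [max_le_iff] at hj
      have h1 : (A ^ (j + 1)) (f (j + 1)) - (A ^ j) (f j) = (A ^ j) (A (f (j + 1)) - f j) := by
        rw [pow_succ, map_sub]; rfl
      rw [h1]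
      have h2 := hc k n j hj.2 (A (f (j + 1)) - f j)
      refine h2.trans ?_
      refine (mul_le_mul (hb k n j hj.1.1 hj.1.2) (hdiff j) (norm_nonneg _) (hb0 j).le).trans_eq ?_
      exact mul_div_cancel₀ _ (hb0 j).ne'
  refine ⟨G, tendsto_nhds_unique (((toL2 E).continuous.tendsto G).comp hG) ?_⟩
  rw [tendsto_iff_norm_sub_tendsto_zero]
  refine squeeze_zero (fun _ => norm_nonneg _) (fun j => ?_)
    (tendsto_pow_atTop_nhds_zero_of_lt_one (r := (1 / 2 : ℝ)) (by norm_num) (by norm_num))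
  exact (hpow j (f j)).trans ((hle j j (by omega)).trans (min_le_right _ _))

end Regularity

section AdjointPairs

open scoped ContDiff SchwartzMap FourierTransform LineDeriv Laplacian ComplexConjugate
open SchwartzMap LineDeriv

set_option linter.unusedSectionVars false

variable {E : Type*} [NormedAddCommGroup E] [InnerProductSpace ℝ E] [FiniteDimensional ℝ E]
  [MeasurableSpace E] [BorelSpace E]

/-- `B` is the formal adjoint of `A` with respect to the `L²` inner product. -/
def AdjointPair (A B : 𝓢(E, ℂ) →L[ℂ] 𝓢(E, ℂ)) : Prop :=
  ∀ f g, inner ℂ (toL2 E (A f)) (toL2 E g) = inner ℂ (toL2 E f) (toL2 E (B g))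

namespace AdjointPair

variable {A B A' B' : 𝓢(E, ℂ) →L[ℂ] 𝓢(E, ℂ)}

theorem add (h : AdjointPair A B) (h' : AdjointPair A' B') : AdjointPair (A + A') (B + B') :=
  fun f g => by
    simp only [_root_.add_apply, map_add, inner_add_left, inner_add_right, h f g, h' f g]

theorem neg (h : AdjointPair A B) : AdjointPair (-A) (-B) := fun f g => by
  simp only [_root_.neg_apply, map_neg, inner_neg_left, inner_neg_right, h f g]

theorem sub (h : AdjointPair A B) (h' : AdjointPair A' B') : AdjointPair (A - A') (B - B') := by
  simpa only [sub_eq_add_neg] using h.add h'.neg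

theorem mul (h : AdjointPair A B) (h' : AdjointPair A' B') : AdjointPair (A * A') (B' * B) :=
  fun f g => by
    rw [mul_apply_eq_comp, mul_apply_eq_comp, h (A' f) g, h' f (B g)]

theorem mulOp {a : E → ℂ} (ha : a.HasTemperateGrowth)
    (ha' : (fun x => conj (a x)).HasTemperateGrowth) :
    AdjointPair (mulOp a) (mulOp fun x => conj (a x)) := fun f g => by
  simp only [toLpCLM_apply, inner_toL2_toL2_eq]
  congr 1 with x
  simp only [smulLeftCLM_apply_apply ha, smulLeftCLM_apply_apply ha', smul_eq_mul,
    RCLike.inner_apply, map_mul]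
  ring

theorem mulOp_ofReal {a : E → ℝ} (ha : (fun x => (a x : ℂ)).HasTemperateGrowth) :
    AdjointPair (_root_.mulOp fun x => (a x : ℂ)) (_root_.mulOp fun x => (a x : ℂ)) := by
  simpa only [Complex.conj_ofReal] using mulOp ha (by simpa only [Complex.conj_ofReal] using ha)

theorem fourierOp {a : E → ℂ} (ha : a.HasTemperateGrowth)
    (ha' : (fun x => conj (a x)).HasTemperateGrowth) :
    AdjointPair (fourierOp a) (fourierOp fun x => conj (a x)) := fun f g => by
  have h := mulOp ha ha' (𝓕 f) (𝓕 g)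
  simp only [toLpCLM_apply] at h ⊢
  rw [fourierMultiplierCLM_apply, fourierMultiplierCLM_apply, ← inner_fourier_toL2_eq,
    ← inner_fourier_toL2_eq f, FourierTransform.fourier_fourierInv_eq,
    FourierTransform.fourier_fourierInv_eq, h]

theorem fourierOp_ofReal {a : E → ℝ} (ha : (fun x => (a x : ℂ)).HasTemperateGrowth) :
    AdjointPair (_root_.fourierOp fun x => (a x : ℂ)) (_root_.fourierOp fun x => (a x : ℂ)) := by
  simpa only [Complex.conj_ofReal] using fourierOp ha (by simpa only [Complex.conj_ofReal] using ha)

theorem derivOp (v : E) : AdjointPair (derivOp v) (-derivOp v) := by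
  have h : (fun ξ : E => (2 * Real.pi * Complex.I) * ((inner ℝ ξ v : ℝ) : ℂ)).HasTemperateGrowth :=
    ((isSymbol_coord v).const_mul _).hasTemperateGrowth
  have h' : (fun ξ : E => conj ((2 * Real.pi * Complex.I) * ((inner ℝ ξ v : ℝ) : ℂ))) =
      fun ξ => -((2 * Real.pi * Complex.I) * ((inner ℝ ξ v : ℝ) : ℂ)) := by
    ext; simp [Complex.conj_ofNat]
  have h2 := fourierOp h (by rw [h']; exact h.neg)
  rw [h'] at h2
  rw [derivOp_eq_fourierOp]
  intro f g
  rw [h2 f g]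
  congr 2
  have := fourierMultiplierCLM_smul (F := ℂ) h (-1)
  rw [neg_smul, neg_smul, one_smul, one_smul] at this
  exact congrArg (fun T => T g) this

theorem sum {ι : Type*} {s : Finset ι} {S T : ι → 𝓢(E, ℂ) →L[ℂ] 𝓢(E, ℂ)}
    (h : ∀ i ∈ s, AdjointPair (S i) (T i)) : AdjointPair (∑ i ∈ s, S i) (∑ i ∈ s, T i) :=
  fun f g => by
    simp only [_root_.sum_apply, map_sum, sum_inner, inner_sum]
    exact Finset.sum_congr rfl fun i hi => h i hi f g

end AdjointPair

variable (E) in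
/-- The Laplacian on Schwartz functions. -/
abbrev lapOp : 𝓢(E, ℂ) →L[ℂ] 𝓢(E, ℂ) := laplacianCLM ℂ E 𝓢(E, ℂ)

theorem lapOp_apply (f : 𝓢(E, ℂ)) : lapOp E f = Δ f := laplacianCLM_eq ℂ f

theorem lapOp_eq_sum {ι : Type*} [Fintype ι] (b : OrthonormalBasis ι ℝ E) :
    lapOp E = ∑ i, derivOp (b i) * derivOp (b i) := by
  ext1 f
  rw [lapOp_apply, laplacian_eq_sum b, _root_.sum_apply]
  rfl

theorem lapOp_eq_fourierOp :
    lapOp E = fourierOp fun ξ : E => ((-(4 * Real.pi ^ 2 * ‖ξ‖ ^ 2) : ℝ) : ℂ) := by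
  ext1 f
  have h : (fun ξ : E => ‖ξ‖ ^ 2).HasTemperateGrowth := by fun_prop
  have h2 := fourierMultiplierCLM_smul (𝕜 := ℝ) (F := ℂ) h (-(2 * Real.pi) ^ 2)
  rw [lapOp_apply, laplacian_eq_fourierMultiplierCLM, ← _root_.smul_apply, ← h2,
    ← fourierMultiplierCLM_ofReal ℂ]
  · congr 2; ext ξ
    exact congrArg Complex.ofReal (by
      simp only [Pi.smul_apply, smul_eq_mul, RCLike.ofReal_real_eq_id, id]; ring)
  · fun_prop

theorem AdjointPair.lapOp : AdjointPair (lapOp E) (lapOp E) := by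
  rw [lapOp_eq_sum (stdOrthonormalBasis ℝ E)]
  refine AdjointPair.sum fun i _ => ?_
  simpa using (AdjointPair.derivOp (stdOrthonormalBasis ℝ E i)).mul (AdjointPair.derivOp _)

/-- The Schrödinger operator `-Δ - V`. -/
def schrodinger (V : E → ℝ) : 𝓢(E, ℂ) →L[ℂ] 𝓢(E, ℂ) := -lapOp E - mulOp fun x => (V x : ℂ)

theorem AdjointPair.schrodinger {V : E → ℝ} (hV : (fun x => (V x : ℂ)).HasTemperateGrowth) :
    AdjointPair (schrodinger V) (schrodinger V) := AdjointPair.lapOp.neg.sub (.mulOp_ofReal hV)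

end AdjointPairs

section EllipticRegularity

open scoped ContDiff SchwartzMap FourierTransform LineDeriv Laplacian ComplexConjugate
open SchwartzMap LineDeriv

set_option linter.unusedSectionVars false

variable {E : Type*} [NormedAddCommGroup E] [InnerProductSpace ℝ E] [FiniteDimensional ℝ E]
  [MeasurableSpace E] [BorelSpace E]

theorem mulOp_mul_derivOp_sq {m : ℤ} {a : E → ℂ} (ha : IsSymbol m a) (v : E) :
    mulOp a * (derivOp v * derivOp v) = derivOp v * derivOp v * mulOp a
      - (2 : ℂ) • (derivOp v * mulOp fun x => fderiv ℝ a x v)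
      + mulOp fun x => fderiv ℝ (fun y => fderiv ℝ a y v) x v := by
  have h1 := derivOp_mul_mulOp ha v
  have h2 := derivOp_mul_mulOp (ha.fderiv_apply v) v
  rw [← sub_eq_iff_eq_add] at h1 h2
  rw [← mul_assoc, ← h1, sub_mul, mul_assoc, ← h1, two_smul, ← h2]
  noncomm_ring

theorem isSymbol_norm_sq : IsSymbol 2 (fun ξ : E => ((‖ξ‖ ^ 2 : ℝ) : ℂ)) := by
  let b := stdOrthonormalBasis ℝ E
  have h : IsSymbol 2 (fun ξ : E => ∑ i, ((inner ℝ ξ (b i) : ℝ) : ℂ) ^ 2) :=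
    IsSymbol.sum fun i _ => (isSymbol_coord (b i)).pow 2
  refine (congrArg _ ?_).mp h
  ext ξ
  rw [← b.sum_sq_inner_left]
  push_cast
  rfl

/-- The symbol of the inverse of `Δ² + m`. -/
def bilaplacianResolvent (m : ℝ) (ξ : E) : ℝ := ((4 * Real.pi ^ 2 * ‖ξ‖ ^ 2) ^ 2 + m)⁻¹

theorem isSymbol_bilaplacianResolvent {m : ℝ} (hm : 0 < m) :
    IsSymbol (-4) (fun ξ : E => (bilaplacianResolvent m ξ : ℂ)) := by
  have h : IsSymbol 4 (fun ξ : E =>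
      (((4 * Real.pi ^ 2 : ℝ) : ℂ) * ((‖ξ‖ ^ 2 : ℝ) : ℂ)) ^ 2 + (m : ℂ)) :=
    ((isSymbol_norm_sq.const_mul _).pow 2).add ((IsSymbol.const _).mono (by norm_num))
  have h2 := h.inv (c := min 1 m / 8) (by positivity) fun ξ => by
    have h3 : (((4 * Real.pi ^ 2 : ℝ) : ℂ) * ((‖ξ‖ ^ 2 : ℝ) : ℂ)) ^ 2 + (m : ℂ) =
      (((4 * Real.pi ^ 2 * ‖ξ‖ ^ 2) ^ 2 + m : ℝ) : ℂ) := by push_cast; ring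
    rw [h3, Complex.norm_real, Real.norm_of_nonneg (by positivity)]
    have h4 : (1 + ‖ξ‖) ^ (4 : ℤ) ≤ 8 * (1 + (‖ξ‖ ^ 2) ^ 2) := by
      rw [show (4 : ℤ) = (4 : ℕ) from rfl, zpow_natCast]
      nlinarith [sq_nonneg (1 - ‖ξ‖), sq_nonneg (1 - ‖ξ‖ ^ 2), norm_nonneg ξ,
        sq_nonneg ((1 + ‖ξ‖) * (1 - ‖ξ‖))]
    have h5 : (1 : ℝ) ≤ 4 * Real.pi ^ 2 := by nlinarith [Real.pi_gt_three]
    have h6 : ‖ξ‖ ^ 2 ≤ 4 * Real.pi ^ 2 * ‖ξ‖ ^ 2 := by nlinarith [sq_nonneg ‖ξ‖]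
    have h7 : (‖ξ‖ ^ 2) ^ 2 ≤ (4 * Real.pi ^ 2 * ‖ξ‖ ^ 2) ^ 2 := by gcongr
    have h8 : min 1 m ≤ 1 := min_le_left _ _
    have h9 : min 1 m ≤ m := min_le_right _ _
    have h10 : 0 < min 1 m := by positivity
    nlinarith [mul_le_mul_of_nonneg_left h4 h10.le, sq_nonneg (‖ξ‖ ^ 2)]
  refine (congrArg _ ?_).mp h2
  ext ξ
  simp [bilaplacianResolvent]


theorem fourierOp_mul_mulOp_mul_lapOp_mem_gain {σ a : E → ℂ} (hσ : IsSymbol (-3) σ)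
    (ha : IsSymbol (-1) a) : fourierOp σ * (mulOp a * lapOp E) ∈ gain E 1 := by
  rw [lapOp_eq_sum (stdOrthonormalBasis ℝ E), Finset.mul_sum, Finset.mul_sum]
  refine sum_mem fun i _ => ?_
  set v := stdOrthonormalBasis ℝ E i
  have hD : IsSymbol 1 (fun ξ : E => (2 * Real.pi * Complex.I) * ((inner ℝ ξ v : ℝ) : ℂ)) :=
    (isSymbol_coord v).const_mul _
  have hDσ := hσ.mul hD
  rw [mulOp_mul_derivOp_sq ha, mul_add, mul_sub, mul_smul_comm, ← mul_assoc, ← mul_assoc,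
    ← mul_assoc, derivOp_eq_fourierOp,
    fourierOp_mul hσ.hasTemperateGrowth hD.hasTemperateGrowth,
    fourierOp_mul hDσ.hasTemperateGrowth hD.hasTemperateGrowth]
  exact add_mem (sub_mem (fourierOp_mul_mulOp_mem_gain ((hDσ.mul hD).mono (by norm_num)) ha)
    (Submodule.smul_mem _ _ (fourierOp_mul_mulOp_mem_gain (hDσ.mono (by norm_num))
      (ha.fderiv_apply v))))
    (fourierOp_mul_mulOp_mem_gain (hσ.mono (by norm_num)) ((ha.fderiv_apply v).fderiv_apply v))

theorem fourierOp_mul_lapOp_mul_mulOp_mem_gain {σ a : E → ℂ} (hσ : IsSymbol (-3) σ)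
    (ha : IsSymbol (-1) a) : fourierOp σ * (lapOp E * mulOp a) ∈ gain E 1 := by
  have h : IsSymbol 2 (fun ξ : E => ((-(4 * Real.pi ^ 2 * ‖ξ‖ ^ 2) : ℝ) : ℂ)) := by
    refine (congrArg _ ?_).mp (isSymbol_norm_sq.const_mul (-(4 * Real.pi ^ 2)))
    ext ξ; push_cast; ring
  rw [← mul_assoc, lapOp_eq_fourierOp, fourierOp_mul hσ.hasTemperateGrowth h.hasTemperateGrowth]
  exact fourierOp_mul_mulOp_mem_gain ((hσ.mul h).mono (by norm_num)) ha

theorem fourierOp_add {a b : E → ℂ} (ha : a.HasTemperateGrowth) (hb : b.HasTemperateGrowth) :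
    fourierOp (fun x => a x + b x) = fourierOp a + fourierOp b := by
  have h := fourierMultiplierCLM_sum ℂ (g := ![a, b]) (s := Finset.univ) (fun i _ => by
    fin_cases i
    · exact ha
    · exact hb)
  rw [Fin.sum_univ_two] at h
  simp only [Fin.sum_univ_two] at h
  exact h

theorem lapOp_sq_add_mul_fourierOp {m : ℝ} (hm : 0 < m) :
    (lapOp E * lapOp E + (m : ℂ) • 1) * fourierOp (fun ξ : E => (bilaplacianResolvent m ξ : ℂ)) =
      1 := by
  have h : (fun ξ : E => ((-(4 * Real.pi ^ 2 * ‖ξ‖ ^ 2) : ℝ) : ℂ)).HasTemperateGrowth := by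
    have h := (isSymbol_norm_sq.const_mul (E := E) (-(4 * Real.pi ^ 2))).hasTemperateGrowth
    refine (congrArg _ ?_).mp h
    ext ξ; push_cast; ring
  have hr := (isSymbol_bilaplacianResolvent (E := E) hm).hasTemperateGrowth
  have h1 : ((m : ℂ) • 1 : 𝓢(E, ℂ) →L[ℂ] 𝓢(E, ℂ)) = fourierOp fun _ => (m : ℂ) :=
    (fourierMultiplierCLM_const (F := ℂ) (m : ℂ)).symm
  have hc : (fun _ : E => (m : ℂ)).HasTemperateGrowth := .const _
  rw [h1, lapOp_eq_fourierOp, fourierOp_mul h h]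
  refine (congrArg (· * _) (fourierOp_add (h.mul h) hc).symm).trans ?_
  refine (fourierOp_mul ((h.mul h).add hc) hr).trans ?_
  have h2 : ∀ ξ : E, (((-(4 * Real.pi ^ 2 * ‖ξ‖ ^ 2) : ℝ) : ℂ) *
      ((-(4 * Real.pi ^ 2 * ‖ξ‖ ^ 2) : ℝ) : ℂ) + m) * (bilaplacianResolvent m ξ : ℂ) = 1 :=
    fun ξ => by
      have : (4 * Real.pi ^ 2 * ‖ξ‖ ^ 2) ^ 2 + m ≠ 0 := by positivity
      rw [bilaplacianResolvent]
      norm_cast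
      field_simp
  refine (congrArg fourierOp (funext h2)).trans ?_
  exact (fourierMultiplierCLM_const (F := ℂ) (1 : ℂ)).trans (one_smul _ _)

/-- Square-integrable weak solutions of `(-Δ - U)(-Δ - V) u = -m u` (tested against the formal
adjoint) are Schwartz functions. -/
theorem exists_toL2_eq_of_schrodinger {U V : E → ℝ} (hU : IsSymbol (-1) (fun x => (U x : ℂ)))
    (hV : IsSymbol (-1) (fun x => (V x : ℂ))) {m : ℝ} (hm : 0 < m)
    {u : Lp ℂ 2 (volume : Measure E)}
    (hu : ∀ ψ, inner ℂ u (toL2 E (schrodinger U (schrodinger V ψ) + (m : ℂ) • ψ)) = 0) :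
    ∃ g, toL2 E g = u := by
  have hr := isSymbol_bilaplacianResolvent (E := E) hm
  have hr3 := hr.mono (m' := -3) (by norm_num)
  set R := fourierOp (fun ξ : E => (bilaplacianResolvent m ξ : ℂ)) with hR
  set MU := mulOp (fun x => (U x : ℂ)) with hMU
  set MV := mulOp (fun x => (V x : ℂ)) with hMV
  have hadj : AdjointPair (-(R * (MV * lapOp E + lapOp E * MU + MV * MU)))
      (-((lapOp E * MV + MU * lapOp E + MU * MV) * R)) := by
    have hMU' := AdjointPair.mulOp_ofReal hU.hasTemperateGrowth
    have hMV' := AdjointPair.mulOp_ofReal hV.hasTemperateGrowth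
    have hR' := AdjointPair.fourierOp_ofReal hr.hasTemperateGrowth
    exact (hR'.mul (((hMV'.mul .lapOp).add (AdjointPair.lapOp.mul hMU')).add (hMV'.mul hMU'))).neg
  refine exists_toL2_eq_of_mem_gain (A := -(R * (MV * lapOp E + lapOp E * MU + MV * MU)))
    (B := -((lapOp E * MV + MU * lapOp E + MU * MV) * R)) ?_ hadj fun ψ => ?_
  · rw [mul_add, mul_add]
    refine neg_mem (add_mem (add_mem (fourierOp_mul_mulOp_mul_lapOp_mem_gain hr3 hV)
      (fourierOp_mul_lapOp_mul_mulOp_mem_gain hr3 hU)) ?_)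
    rw [hMU, hMV, mulOp_mul hV.hasTemperateGrowth hU.hasTemperateGrowth]
    exact fourierOp_mul_mulOp_mem_gain (hr.mono (by norm_num)) ((hV.mul hU).mono (by norm_num))
  · have h1 := hu (R ψ)
    have h2 := congrArg (fun T => T ψ) (lapOp_sq_add_mul_fourierOp (E := E) hm)
    have h3 : schrodinger U (schrodinger V (R ψ)) + (m : ℂ) • R ψ =
        ψ - (-((lapOp E * MV + MU * lapOp E + MU * MV) * R)) ψ := by
      have h4 : lapOp E (lapOp E (R ψ)) + (m : ℂ) • R ψ = ψ := h2
      nth_rw 3 [← h4]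
      simp only [schrodinger, mul_apply_eq_comp, _root_.add_apply, _root_.neg_apply,
        _root_.sub_apply, map_sub, map_neg]
      abel
    rw [h3, map_sub, inner_sub_right, sub_eq_zero] at h1
    exact h1

end EllipticRegularity

section Variational

open scoped ContDiff SchwartzMap Topology ComplexConjugate
open SchwartzMap Filter

set_option linter.unusedSectionVars false

variable {E : Type*} [NormedAddCommGroup E] [InnerProductSpace ℝ E] [FiniteDimensional ℝ E]
  [MeasurableSpace E] [BorelSpace E]

/-- The quadratic form of an operator on Schwartz functions. -/
def quadForm (T : 𝓢(E, ℂ) →L[ℂ] 𝓢(E, ℂ)) (f : 𝓢(E, ℂ)) : ℝ :=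
  (inner ℂ (toL2 E (T f)) (toL2 E f)).re

theorem quadForm_add (S T : 𝓢(E, ℂ) →L[ℂ] 𝓢(E, ℂ)) (f : 𝓢(E, ℂ)) :
    quadForm (S + T) f = quadForm S f + quadForm T f := by
  simp only [quadForm, _root_.add_apply, map_add, inner_add_left, Complex.add_re]

theorem quadForm_sub (S T : 𝓢(E, ℂ) →L[ℂ] 𝓢(E, ℂ)) (f : 𝓢(E, ℂ)) :
    quadForm (S - T) f = quadForm S f - quadForm T f := by
  simp only [quadForm, _root_.sub_apply, map_sub, inner_sub_left, Complex.sub_re]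

theorem quadForm_real_smul (c : ℝ) (T : 𝓢(E, ℂ) →L[ℂ] 𝓢(E, ℂ)) (f : 𝓢(E, ℂ)) :
    quadForm ((c : ℂ) • T) f = c * quadForm T f := by
  simp only [quadForm, _root_.smul_apply, map_smul, inner_smul_left, Complex.conj_ofReal,
    Complex.re_ofReal_mul]

theorem quadForm_apply_real_smul (c : ℝ) (T : 𝓢(E, ℂ) →L[ℂ] 𝓢(E, ℂ)) (f : 𝓢(E, ℂ)) :
    quadForm T ((c : ℂ) • f) = c ^ 2 * quadForm T f := by
  simp only [quadForm, map_smul, inner_smul_left, inner_smul_right, Complex.conj_ofReal,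
    Complex.re_ofReal_mul]
  ring

theorem quadForm_one (f : 𝓢(E, ℂ)) : quadForm 1 f = normL2 f ^ 2 := by
  rw [quadForm, normL2_eq]
  exact inner_self_eq_norm_sq (𝕜 := ℂ) (toL2 E f)

theorem AdjointPair.norm_inner_sq_le {T : 𝓢(E, ℂ) →L[ℂ] 𝓢(E, ℂ)} (hT : AdjointPair T T)
    (h0 : ∀ f, 0 ≤ quadForm T f) (f g : 𝓢(E, ℂ)) :
    ‖inner ℂ (toL2 E (T f)) (toL2 E g)‖ ^ 2 ≤ quadForm T f * quadForm T g := by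
  let c : PreInnerProductSpace.Core ℂ 𝓢(E, ℂ) :=
    { inner := fun f g => inner ℂ (toL2 E (T f)) (toL2 E g)
      conj_inner_symm := fun f g => by rw [inner_conj_symm, hT]
      re_inner_nonneg := h0
      add_left := fun f g h => by rw [map_add, map_add, inner_add_left]
      smul_left := fun f g r => by rw [map_smul, map_smul, inner_smul_left] }
  have h := @InnerProductSpace.Core.inner_mul_inner_self_le ℂ 𝓢(E, ℂ) _ _ _ c f g
  have h2 : inner ℂ (toL2 E (T g)) (toL2 E f) = conj (inner ℂ (toL2 E (T f)) (toL2 E g)) := by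
    rw [inner_conj_symm, hT]
  have h3 : ‖inner ℂ (toL2 E (T f)) (toL2 E g)‖ * ‖inner ℂ (toL2 E (T g)) (toL2 E f)‖ ≤
      quadForm T f * quadForm T g := h
  rw [h2, RCLike.norm_conj, ← sq] at h3
  exact h3

theorem exists_minimizing_sequence {L M : 𝓢(E, ℂ) →L[ℂ] 𝓢(E, ℂ)} (hL : AdjointPair L L)
    (hM : AdjointPair M M) (hL0 : ∀ f, 0 ≤ quadForm L f) {C : ℝ} (hC : 0 ≤ C)
    (hMC : ∀ f, quadForm M f ≤ C * normL2 f ^ 2)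
    (hneg : ∃ φ, quadForm (L - M) (L φ) < 0) :
    ∃ m : ℝ, 0 < m ∧ ∃ f : ℕ → 𝓢(E, ℂ), (∀ k, normL2 (f k) ^ 2 ≤ C) ∧
      (∀ k, quadForm L (f k) ≤ C ^ 2) ∧ (∀ k, m / 2 ≤ quadForm M (f k)) ∧
      ∀ ψ, Tendsto (fun k => inner ℂ (toL2 E (f k)) (toL2 E ((L - M) (L ψ) + (m : ℂ) • ψ)))
        atTop (𝓝 0) := by
  have hnorm : ∀ φ, (normL2 (L φ) ^ 2) ^ 2 ≤ quadForm L φ * quadForm L (L φ) := fun φ => by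
    have h := hL.norm_inner_sq_le hL0 φ (L φ)
    rwa [inner_self_eq_norm_sq_to_K, norm_pow, RCLike.norm_ofReal, abs_norm] at h
  let S : Set ℝ := {t | 0 ≤ t ∧ ∀ φ, 0 ≤ quadForm (L - M) (L φ) + t * quadForm L φ}
  have hS : S.Nonempty := ⟨C ^ 2 / 4, by positivity, fun φ => by
    rw [quadForm_sub]
    have h1 := hMC (L φ)
    have h2 := hnorm φ
    have h3 := hL0 φ
    have h4 := hL0 (L φ)
    have h5 : C * normL2 (L φ) ^ 2 ≤ quadForm L (L φ) + C ^ 2 / 4 * quadForm L φ := by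
      refine abs_le_of_sq_le_sq' ?_ (by positivity) |>.2
      nlinarith [sq_nonneg (quadForm L (L φ) - C ^ 2 / 4 * quadForm L φ),
        mul_le_mul_of_nonneg_left h2 (sq_nonneg C)]
    linarith⟩
  have hSb : BddBelow S := ⟨0, fun t ht => ht.1⟩
  have hSc : IsClosed S := by
    have : S = Set.Ici 0 ∩ ⋂ φ, {t | 0 ≤ quadForm (L - M) (L φ) + t * quadForm L φ} := by
      ext t; simp [S]
    rw [this]
    exact isClosed_Ici.inter (isClosed_iInter fun φ => isClosed_le (by fun_prop) (by fun_prop))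
  set m := sInf S with hm
  have hmS : m ∈ S := hSc.csInf_mem hS hSb
  have hm0 : 0 < m := by
    obtain ⟨φ, hφ⟩ := hneg
    have := hmS.2 φ
    rcases hmS.1.eq_or_lt with h | h
    · rw [← h] at this; linarith
    · exact h
  have hex : ∀ k : ℕ, ∃ φ, quadForm L φ = 1 ∧
      quadForm (L - M) (L φ) < -(m * (1 - 1 / (k + 2))) := fun k => by
    have hk : (0 : ℝ) < 1 / (k + 2) := by positivity
    have hk' : (1 : ℝ) / (k + 2) ≤ 1 := by
      rw [div_le_one (by positivity)]; linarith [(Nat.cast_nonneg k : (0 : ℝ) ≤ k)]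
    have h1 : m * (1 - 1 / (k + 2)) ∉ S := notMem_of_lt_csInf (by nlinarith) hSb
    have h2 : ∃ φ, quadForm (L - M) (L φ) + m * (1 - 1 / (k + 2)) * quadForm L φ < 0 := by
      by_contra! h
      exact h1 ⟨mul_nonneg hm0.le (by linarith), h⟩
    obtain ⟨φ, hφ⟩ := h2
    have h3 := hmS.2 φ
    have h4 : 0 < quadForm L φ := by
      refine (hL0 φ).lt_of_ne fun h => ?_
      rw [← h] at h3 hφ
      linarith
    have h5 : ((Real.sqrt (quadForm L φ))⁻¹) ^ 2 * quadForm L φ = 1 := by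
      rw [inv_pow, Real.sq_sqrt h4.le, inv_mul_cancel₀ h4.ne']
    refine ⟨((Real.sqrt (quadForm L φ))⁻¹ : ℝ) • φ, ?_, ?_⟩
    · rw [← Complex.coe_smul, quadForm_apply_real_smul, h5]
    · rw [← Complex.coe_smul, map_smul, quadForm_apply_real_smul]
      have h6 : 0 < ((Real.sqrt (quadForm L φ))⁻¹) ^ 2 := by positivity
      have h7 := mul_lt_mul_of_pos_left hφ h6
      rw [mul_add, mul_left_comm, h5] at h7
      linarith
  choose φ hφ1 hφ2 using hex
  have hk : ∀ k : ℕ, m / 2 ≤ m * (1 - 1 / (k + 2)) := fun k => by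
    have : (1 : ℝ) / (k + 2) ≤ 1 / 2 := by gcongr; linarith [(Nat.cast_nonneg k : (0 : ℝ) ≤ k)]
    nlinarith
  have hbound : ∀ k, normL2 (L (φ k)) ^ 2 ≤ C ∧ quadForm L (L (φ k)) ≤ C ^ 2 := fun k => by
    have h1 := hnorm (φ k)
    have h2 := hMC (L (φ k))
    have h3 := hφ2 k
    rw [quadForm_sub] at h3
    rw [hφ1, one_mul] at h1
    have h4 := hk k
    have h5 : quadForm L (L (φ k)) ≤ C * normL2 (L (φ k)) ^ 2 := by linarith
    have h6 : normL2 (L (φ k)) ^ 2 ≤ C := by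
      by_contra! h
      nlinarith [sq_nonneg (normL2 (L (φ k)))]
    exact ⟨h6, h5.trans (by nlinarith)⟩
  refine ⟨m, hm0, fun k => L (φ k), fun k => (hbound k).1, fun k => (hbound k).2, fun k => ?_,
    fun ψ => ?_⟩
  · have h1 := hφ2 k
    rw [quadForm_sub] at h1
    linarith [hk k, hL0 (L (φ k))]
  · let T := L * (L - M) * L + (m : ℂ) • L
    have hT : AdjointPair T T := by
      have h1 := (hL.mul (hL.sub hM)).mul hL
      rw [← mul_assoc] at h1
      refine h1.add fun f g => ?_
      simp only [_root_.smul_apply, map_smul, inner_smul_left, inner_smul_right,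
        Complex.conj_ofReal, hL f g]
    have hqT : ∀ f, quadForm T f = quadForm (L - M) (L f) + m * quadForm L f := fun f => by
      rw [quadForm_add, quadForm_real_smul]
      congr 1
      exact congrArg Complex.re (hL ((L - M) (L f)) f)
    have hT0 : ∀ f, 0 ≤ quadForm T f := fun f => by rw [hqT]; exact hmS.2 f
    have hTi : ∀ f, inner ℂ (toL2 E (T f)) (toL2 E ψ) =
        inner ℂ (toL2 E (L f)) (toL2 E ((L - M) (L ψ) + (m : ℂ) • ψ)) := fun f => by
      have h1 : T f = L ((L - M) (L f)) + (m : ℂ) • L f := rfl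
      rw [h1, map_add, map_add, inner_add_left, inner_add_right, hL, (hL.sub hM) (L f), map_smul,
        map_smul, inner_smul_left, inner_smul_right, Complex.conj_ofReal]
    have hsq : Tendsto (fun k => ‖inner ℂ (toL2 E (L (φ k)))
        (toL2 E ((L - M) (L ψ) + (m : ℂ) • ψ))‖ ^ 2) atTop (𝓝 0) := by
      refine squeeze_zero (g := fun k : ℕ => m * quadForm T ψ * (1 / ((k + 1 : ℕ) + 1)))
        (fun k => by positivity) (fun k => ?_) ?_
      · rw [← hTi]
        refine (hT.norm_inner_sq_le hT0 _ _).trans ?_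
        have h1 : quadForm T (φ k) ≤ m * (1 / ((k + 1 : ℕ) + 1)) := by
          rw [hqT, hφ1]
          have := hφ2 k
          push_cast
          rw [add_assoc, one_add_one_eq_two]
          linarith
        linarith [mul_le_mul_of_nonneg_right h1 (hT0 ψ)]
      · have := (tendsto_one_div_add_atTop_nhds_zero_nat (𝕜 := ℝ)).comp (tendsto_add_atTop_nat 1)
        simpa using this.const_mul (m * quadForm T ψ)
    rw [tendsto_zero_iff_norm_tendsto_zero]
    have := hsq.sqrt
    simpa [Real.sqrt_sq] using this

end Variational

section WeakCompactness

open scoped Topology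
open Filter

theorem exists_weakly_convergent_subseq {H : Type*} [NormedAddCommGroup H] [InnerProductSpace ℂ H]
    [CompleteSpace H] [TopologicalSpace.SeparableSpace H] {x : ℕ → H} {C : ℝ}
    (hx : ∀ k, ‖x k‖ ≤ C) : ∃ (u : H) (φ : ℕ → ℕ), StrictMono φ ∧
      ∀ y, Tendsto (fun k => inner ℂ (x (φ k)) y) atTop (𝓝 (inner ℂ u y)) := by
  obtain ⟨u, -, φ, hφ, hu⟩ := WeakDual.isSeqCompact_closedBall ℂ H 0 C
    (x := fun k => StrongDual.toWeakDual (InnerProductSpace.toDual ℂ H (x k))) fun k => by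
      simpa using hx k
  refine ⟨(InnerProductSpace.toDual ℂ H).symm (WeakDual.toStrongDual u), φ, hφ, fun y => ?_⟩
  have := (WeakDual.eval_continuous y).continuousAt.tendsto.comp hu
  rw [InnerProductSpace.toDual_symm_apply]
  exact this

end WeakCompactness

section Compactness

open scoped ContDiff SchwartzMap Topology ComplexConjugate FourierTransform
open SchwartzMap Filter

set_option linter.unusedSectionVars false

variable {E : Type*} [NormedAddCommGroup E] [InnerProductSpace ℝ E] [FiniteDimensional ℝ E]
  [MeasurableSpace E] [BorelSpace E]

theorem inner_toL2 (f g : 𝓢(E, ℂ)) :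
    inner ℂ (toL2 E f) (toL2 E g) = ∫ x, inner ℂ (f x) (g x) := inner_toL2_toL2_eq f g

theorem quadForm_mulOp {a : E → ℝ} (ha : (fun x => (a x : ℂ)).HasTemperateGrowth) (f : 𝓢(E, ℂ)) :
    quadForm (mulOp fun x => (a x : ℂ)) f = ∫ x, a x * ‖f x‖ ^ 2 := by
  rw [quadForm, inner_toL2, ← Complex.ofReal_re (∫ x, _),
    ← integral_complex_ofReal]
  congr 2 with x
  rw [smulLeftCLM_apply_apply ha, smul_eq_mul, RCLike.inner_apply, map_mul, Complex.conj_ofReal,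
    mul_left_comm, Complex.mul_conj, Complex.normSq_eq_norm_sq]
  push_cast
  rfl

theorem quadForm_fourierOp (a : E → ℂ) (f : 𝓢(E, ℂ)) :
    quadForm (fourierOp a) f = quadForm (mulOp a) (𝓕 f) := by
  rw [quadForm, quadForm, fourierMultiplierCLM_apply, toLpCLM_apply, toLpCLM_apply,
    ← inner_fourier_toL2_eq, FourierTransform.fourier_fourierInv_eq]
  rfl

theorem quadForm_mulOp_mono {a b : E → ℝ} (ha : (fun x => (a x : ℂ)).HasTemperateGrowth)
    (hb : (fun x => (b x : ℂ)).HasTemperateGrowth) (h : ∀ x, a x ≤ b x) (f : 𝓢(E, ℂ)) :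
    quadForm (mulOp fun x => (a x : ℂ)) f ≤ quadForm (mulOp fun x => (b x : ℂ)) f := by
  have h1 : (fun x => ((b x - a x : ℝ) : ℂ)).HasTemperateGrowth := by
    simp only [Complex.ofReal_sub]
    exact hb.sub ha
  have h2 : (mulOp fun x => (b x : ℂ)) - (mulOp fun x => (a x : ℂ)) =
      mulOp fun x => ((b x - a x : ℝ) : ℂ) := by
    simp only [Complex.ofReal_sub]
    exact (smulLeftCLM_sub hb ha).symm
  rw [← sub_nonneg, ← quadForm_sub, h2, quadForm_mulOp h1]
  exact integral_nonneg fun x => mul_nonneg (sub_nonneg.2 (h x)) (sq_nonneg _)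

theorem quadForm_fourierOp_mono {a b : E → ℝ} (ha : (fun x => (a x : ℂ)).HasTemperateGrowth)
    (hb : (fun x => (b x : ℂ)).HasTemperateGrowth) (h : ∀ x, a x ≤ b x) (f : 𝓢(E, ℂ)) :
    quadForm (fourierOp fun x => (a x : ℂ)) f ≤ quadForm (fourierOp fun x => (b x : ℂ)) f := by
  rw [quadForm_fourierOp, quadForm_fourierOp]
  exact quadForm_mulOp_mono ha hb h _

theorem quadForm_mulOp_le {a : E → ℝ} (ha : (fun x => (a x : ℂ)).HasTemperateGrowth) {C : ℝ}
    (h : ∀ x, a x ≤ C) (f : 𝓢(E, ℂ)) :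
    quadForm (mulOp fun x => (a x : ℂ)) f ≤ C * normL2 f ^ 2 := by
  refine (quadForm_mulOp_mono ha (.const _) h f).trans_eq ?_
  rw [← quadForm_one, ← quadForm_real_smul]
  congr 1
  exact smulLeftCLM_const _

/-- A smooth cutoff in frequency converts weak convergence to pointwise convergence. -/
theorem exists_inner_eq_fourierOp_apply {G : E → ℝ} (hG : HasCompactSupport G)
    (hG' : ContDiff ℝ ∞ G) : ∃ C, ∀ x : E, ∃ h : 𝓢(E, ℂ), normL2 h ≤ C ∧ ∀ f,
      fourierOp (fun ξ => (G ξ : ℂ)) f x = inner ℂ (toL2 E h) (toL2 E f) := by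
  have hGc : HasCompactSupport fun ξ => (G ξ : ℂ) := hG.comp_left (g := Complex.ofReal) rfl
  have hGs : ContDiff ℝ ∞ fun ξ => (G ξ : ℂ) := Complex.ofRealCLM.contDiff.comp hG'
  let G₀ : 𝓢(E, ℂ) := hGc.toSchwartzMap hGs
  refine ⟨normL2 G₀, fun x => ?_⟩
  let e : E → ℂ := fun ξ => Complex.exp (-(2 * Real.pi * (inner ℝ ξ x : ℝ)) * Complex.I)
  have hes : ContDiff ℝ ∞ e :=
    (((contDiff_const.mul (Complex.ofRealCLM.contDiff.comp
      (contDiff_id.inner ℝ contDiff_const))).neg).mul contDiff_const).cexp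
  let k : 𝓢(E, ℂ) := (hGc.mul_left (f := e)).toSchwartzMap (hes.mul hGs)
  have hk : ∀ ξ, k ξ = e ξ * G ξ := fun ξ => rfl
  refine ⟨𝓕⁻ k, ?_, fun f => ?_⟩
  · rw [normL2_fourierInv, ← one_mul (normL2 G₀)]
    refine normL2_le_of_norm_le fun ξ => ?_
    have h1 : ‖e ξ‖ = 1 := by
      simp only [e]
      rw [← Complex.norm_exp_ofReal_mul_I (-(2 * Real.pi * inner ℝ ξ x))]
      push_cast; rfl
    have h2 : G₀ ξ = G ξ := rfl
    rw [hk, norm_mul, h1, h2]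
  · have h1 := inner_fourier_toL2_eq (𝓕⁻ k) f
    rw [FourierTransform.fourier_fourierInv_eq] at h1
    refine Eq.trans ?_ ((inner_toL2 k (𝓕 f)).symm.trans h1)
    rw [fourierMultiplierCLM_apply,
      fourierInv_coe, Real.fourierInv_eq']
    congr 1 with ξ
    have hT : (fun ξ => (G ξ : ℂ)).HasTemperateGrowth := G₀.hasTemperateGrowth
    rw [hk, RCLike.inner_apply, smulLeftCLM_apply_apply hT, map_mul, smul_eq_mul, smul_eq_mul]
    simp only [e]
    rw [← Complex.exp_conj]
    simp [Complex.conj_ofNat]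
    ring

theorem exists_frequency_cutoff {δ : ℝ} (hδ : 0 < δ) : ∃ G : E → ℝ, HasCompactSupport G ∧
    ContDiff ℝ ∞ G ∧ (∀ ξ, ‖(G ξ : ℂ)‖ ≤ 1) ∧
    ∀ ξ, (1 - G ξ) ^ 2 ≤ δ * (4 * Real.pi ^ 2 * ‖ξ‖ ^ 2) := by
  have hN : 0 < (Real.sqrt δ)⁻¹ := by positivity
  let G : ContDiffBump (0 : E) := ⟨(Real.sqrt δ)⁻¹, (Real.sqrt δ)⁻¹ + 1, hN, by linarith⟩
  refine ⟨G, G.hasCompactSupport, G.contDiff, fun ξ => ?_, fun ξ => ?_⟩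
  · rw [Complex.norm_real, Real.norm_of_nonneg G.nonneg]
    exact G.le_one
  · rcases le_or_gt ‖ξ‖ (Real.sqrt δ)⁻¹ with h | h
    · rw [G.one_of_mem_closedBall (by simpa using h), sub_self, sq, zero_mul]
      positivity
    · have h1 : 1 ≤ δ * ‖ξ‖ ^ 2 := by
        have h2 : ((Real.sqrt δ)⁻¹) ^ 2 ≤ ‖ξ‖ ^ 2 := by gcongr
        rw [inv_pow, Real.sq_sqrt hδ.le, inv_le_iff_one_le_mul₀ hδ] at h2
        linarith
      have h2 : (1 - G ξ) ^ 2 ≤ 1 := by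
        have := G.nonneg (x := ξ)
        have := G.le_one (x := ξ)
        nlinarith
      nlinarith [Real.pi_gt_three, mul_le_mul_of_nonneg_left h1 (sq_nonneg Real.pi)]

theorem quadForm_add_apply_le {T : 𝓢(E, ℂ) →L[ℂ] 𝓢(E, ℂ)} (h0 : ∀ f, 0 ≤ quadForm T f)
    (f g : 𝓢(E, ℂ)) : quadForm T (f + g) ≤ 2 * quadForm T f + 2 * quadForm T g := by
  have h1 := h0 (f - g)
  simp only [quadForm, map_add, map_sub, inner_add_left, inner_add_right, inner_sub_left,
    inner_sub_right, Complex.add_re, Complex.sub_re] at h1 ⊢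
  linarith

theorem normL2_sub_fourierOp_sq_le {G : E → ℝ} (hG : (fun ξ => (G ξ : ℂ)).HasTemperateGrowth)
    {δ : ℝ} (h : ∀ ξ, (1 - G ξ) ^ 2 ≤ δ * (4 * Real.pi ^ 2 * ‖ξ‖ ^ 2)) (f : 𝓢(E, ℂ)) :
    normL2 (f - fourierOp (fun ξ => (G ξ : ℂ)) f) ^ 2 ≤ δ * quadForm (-lapOp E) f := by
  have h1 : (fun ξ => ((1 - G ξ : ℝ) : ℂ)).HasTemperateGrowth := by
    simp only [Complex.ofReal_sub]
    exact (Function.HasTemperateGrowth.const _).sub hG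
  have h2 : (fun ξ => (((1 - G ξ) ^ 2 : ℝ) : ℂ)).HasTemperateGrowth := by
    simp only [sq, Complex.ofReal_mul]
    exact h1.mul h1
  have h3 : (fun ξ : E => ((δ * (4 * Real.pi ^ 2 * ‖ξ‖ ^ 2) : ℝ) : ℂ)).HasTemperateGrowth := by
    refine (congrArg _ ?_).mp
      (isSymbol_norm_sq.const_mul (E := E) (δ * (4 * Real.pi ^ 2))).hasTemperateGrowth
    ext ξ; push_cast; ring
  have h4 : f - fourierOp (fun ξ => (G ξ : ℂ)) f = fourierOp (fun ξ => ((1 - G ξ : ℝ) : ℂ)) f := by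
    have h5 := fourierOp_add hG h1
    have h6 : fourierOp (fun ξ : E => (G ξ : ℂ) + ((1 - G ξ : ℝ) : ℂ)) = 1 := by
      have : (fun ξ : E => (G ξ : ℂ) + ((1 - G ξ : ℝ) : ℂ)) = fun _ => 1 := by ext ξ; simp
      rw [this]
      exact (fourierMultiplierCLM_const (F := ℂ) (1 : ℂ)).trans (one_smul _ _)
    rw [h6] at h5
    have h7 : f = _ := congrArg (fun T => T f) h5
    nth_rw 1 [h7]
    rw [_root_.add_apply, add_sub_cancel_left]
  have ha : (fun ξ : E => ((-(4 * Real.pi ^ 2 * ‖ξ‖ ^ 2) : ℝ) : ℂ)).HasTemperateGrowth := by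
    refine (congrArg _ ?_).mp
      (isSymbol_norm_sq.const_mul (E := E) (-(4 * Real.pi ^ 2))).hasTemperateGrowth
    ext ξ; push_cast; ring
  have h5 : quadForm (-lapOp E) f = ∫ ξ, 4 * Real.pi ^ 2 * ‖ξ‖ ^ 2 * ‖𝓕 f ξ‖ ^ 2 := by
    have : quadForm (-lapOp E) f = -quadForm (lapOp E) f := by
      simp only [quadForm, _root_.neg_apply, map_neg, inner_neg_left, Complex.neg_re]
    rw [this, lapOp_eq_fourierOp, quadForm_fourierOp, quadForm_mulOp ha, ← integral_neg]
    congr 1 with ξ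
    ring
  have h6 := quadForm_fourierOp_mono h2 h3 h f
  have hS := AdjointPair.fourierOp_ofReal h1
  have h7 : normL2 (fourierOp (fun ξ => ((1 - G ξ : ℝ) : ℂ)) f) ^ 2 =
      quadForm (fourierOp fun ξ => (((1 - G ξ) ^ 2 : ℝ) : ℂ)) f := by
    have h8 : (fourierOp fun ξ => ((1 - G ξ : ℝ) : ℂ)) * (fourierOp fun ξ => ((1 - G ξ : ℝ) : ℂ)) =
        fourierOp fun ξ => (((1 - G ξ) ^ 2 : ℝ) : ℂ) := by
      rw [fourierOp_mul h1 h1]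
      simp only [sq, Complex.ofReal_mul]
    rw [← h8, ← quadForm_one, quadForm, quadForm, mul_apply_eq_comp, hS]
    rfl
  rw [h4, h7, h5, ← integral_const_mul]
  refine h6.trans_eq ?_
  rw [quadForm_fourierOp, quadForm_mulOp h3]
  congr 1 with ξ
  ring

theorem tendsto_integral_mul_sq_norm {χ : E → ℝ} (hχ : Continuous χ) (hχ' : HasCompactSupport χ)
    {g : ℕ → 𝓢(E, ℂ)} {C : ℝ} (hg : ∀ k x, ‖g k x‖ ≤ C)
    (h0 : ∀ x, Tendsto (fun k => g k x) atTop (𝓝 0)) :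
    Tendsto (fun k => ∫ x, χ x * ‖g k x‖ ^ 2) atTop (𝓝 0) := by
  have h := tendsto_integral_of_dominated_convergence (μ := (volume : Measure E))
    (F := fun k x => χ x * ‖g k x‖ ^ 2) (f := fun _ => 0) (fun x => ‖χ x‖ * C ^ 2)
    (fun k => (hχ.mul ((g k).continuous.norm.pow 2)).aestronglyMeasurable)
    ((hχ.integrable_of_hasCompactSupport hχ').norm.mul_const _)
    (fun k => .of_forall fun x => by
      rw [norm_mul, norm_pow, norm_norm]
      gcongr
      exact hg k x)
    (.of_forall fun x => by
      have := ((h0 x).norm.pow 2).const_mul (χ x)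
      simpa using this)
  simpa using h

theorem exists_bump_bound {V : E → ℝ} (hV : IsSymbol (-1) fun x => (V x : ℂ)) {ε : ℝ}
    (hε : 0 < ε) : ∃ χ : E → ℝ, HasCompactSupport χ ∧ ContDiff ℝ ∞ χ ∧ ∀ x, V x ≤ χ x + ε := by
  obtain ⟨K, hK⟩ := hV.norm_le
  have hK' : ∀ x, V x ≤ |K| / (1 + ‖x‖) := fun x => by
    have h := hK x
    rw [Complex.norm_real, zpow_neg_one, ← div_eq_mul_inv] at h
    refine (le_abs_self _).trans (h.trans ?_)
    gcongr
    exact le_abs_self K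
  let G : ContDiffBump (0 : E) := ⟨|K| / ε + 1, |K| / ε + 2, by positivity, by linarith⟩
  refine ⟨fun x => |K| * G x, G.hasCompactSupport.mul_left, contDiff_const.mul G.contDiff,
    fun x => (hK' x).trans ?_⟩
  beta_reduce
  rcases le_or_gt ‖x‖ (|K| / ε + 1) with h | h
  · rw [G.one_of_mem_closedBall (by simpa using h)]
    have : |K| / (1 + ‖x‖) ≤ |K| := div_le_self (abs_nonneg K) (by linarith [norm_nonneg x])
    linarith
  · have h1 : |K| / (1 + ‖x‖) ≤ ε := by
      rw [div_le_iff₀ (by positivity)]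
      have h2 : |K| / ε ≤ 1 + ‖x‖ := by linarith
      rw [div_le_iff₀ hε] at h2
      linarith
    have := mul_nonneg (abs_nonneg K) (G.nonneg (x := x))
    linarith

theorem tendsto_quadForm_mulOp_fourierOp {V G : E → ℝ} (hV : IsSymbol (-1) fun x => (V x : ℂ))
    (hV0 : ∀ x, 0 ≤ V x) (hG : HasCompactSupport G) (hG' : ContDiff ℝ ∞ G)
    {f : ℕ → 𝓢(E, ℂ)} {C : ℝ} (hf : ∀ k, normL2 (f k) ^ 2 ≤ C)
    (h0 : ∀ ψ, Tendsto (fun k => inner ℂ (toL2 E (f k)) (toL2 E ψ)) atTop (𝓝 0)) :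
    Tendsto (fun k => quadForm (mulOp fun x => (V x : ℂ)) (fourierOp (fun ξ => (G ξ : ℂ)) (f k)))
      atTop (𝓝 0) := by
  have hV' := hV.hasTemperateGrowth
  have hsmooth : ∀ {χ : E → ℝ}, HasCompactSupport χ → ContDiff ℝ ∞ χ →
      (fun x => (χ x : ℂ)).HasTemperateGrowth := fun h h' =>
    ((h.comp_left (g := Complex.ofReal) rfl).toSchwartzMap
      (Complex.ofRealCLM.contDiff.comp h')).hasTemperateGrowth
  have hGt := hsmooth hG hG'
  set g : ℕ → 𝓢(E, ℂ) := fun k => fourierOp (fun ξ => (G ξ : ℂ)) (f k) with hg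
  obtain ⟨A, hA⟩ := (hG.comp_left (g := Complex.ofReal) rfl).exists_bound_of_continuous
    (Complex.continuous_ofReal.comp hG'.continuous)
  have hA0 : 0 ≤ A := (norm_nonneg _).trans (hA 0)
  have hfC : ∀ k, normL2 (f k) ≤ Real.sqrt C := fun k => Real.le_sqrt_of_sq_le (hf k)
  have hgn : ∀ k, normL2 (g k) ^ 2 ≤ (A * Real.sqrt C) ^ 2 := fun k => by
    have := (normL2_fourierOp_le hGt hA (f k)).trans (mul_le_mul_of_nonneg_left (hfC k) hA0)
    exact pow_le_pow_left₀ (norm_nonneg _) this 2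
  obtain ⟨D, hD⟩ := exists_inner_eq_fourierOp_apply hG hG'
  have hgx : ∀ k x, ‖g k x‖ ≤ D * Real.sqrt C := fun k x => by
    obtain ⟨h, h1, h2⟩ := hD x
    rw [hg, h2]
    refine (norm_inner_le_norm _ _).trans ?_
    rw [← normL2_eq, ← normL2_eq]
    exact mul_le_mul h1 (hfC k) (norm_nonneg _) ((norm_nonneg _).trans h1)
  have hg0 : ∀ x, Tendsto (fun k => g k x) atTop (𝓝 0) := fun x => by
    obtain ⟨h, -, h2⟩ := hD x
    have h3 := (Complex.continuous_conj.tendsto 0).comp (h0 h)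
    rw [map_zero] at h3
    refine h3.congr fun k => ?_
    rw [hg, h2, ← inner_conj_symm]
    rfl
  rw [Metric.tendsto_atTop']
  intro ε hε
  obtain ⟨χ, hχ, hχ', hVχ⟩ := exists_bump_bound hV
    (show 0 < ε / (2 * ((A * Real.sqrt C) ^ 2 + 1)) by positivity)
  set η := ε / (2 * ((A * Real.sqrt C) ^ 2 + 1)) with hη
  have hη0 : 0 < η := by positivity
  have hχt := hsmooth hχ hχ'
  have h1 := tendsto_integral_mul_sq_norm hχ'.continuous hχ hgx hg0
  obtain ⟨N, hN⟩ := Filter.eventually_atTop.1 (h1.eventually_lt_const (half_pos hε))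
  refine ⟨N, fun k hk => ?_⟩
  rw [Real.dist_0_eq_abs, abs_of_nonneg]
  swap
  · rw [quadForm_mulOp hV']
    exact integral_nonneg fun x => mul_nonneg (hV0 x) (sq_nonneg _)
  have hc : (fun _ : E => (η : ℂ)).HasTemperateGrowth := .const _
  have hsum : (fun x => ((χ x + η : ℝ) : ℂ)).HasTemperateGrowth := by
    simp only [Complex.ofReal_add]
    exact hχt.add hc
  have h2 := quadForm_mulOp_mono hV' hsum hVχ (g k)
  have h3 : (mulOp fun x => ((χ x + η : ℝ) : ℂ)) =
      (mulOp fun x => (χ x : ℂ)) + mulOp fun _ => (η : ℂ) := by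
    simp only [Complex.ofReal_add]
    exact smulLeftCLM_add hχt hc
  rw [h3, quadForm_add, quadForm_mulOp hχt] at h2
  have h4 := quadForm_mulOp_le hc (fun _ => le_rfl) (g k)
  have h5 : η * normL2 (g k) ^ 2 ≤ ε / 2 := by
    refine (mul_le_mul_of_nonneg_left (hgn k) hη0.le).trans ?_
    rw [hη, div_mul_eq_mul_div, div_le_div_iff₀ (by positivity) (by norm_num)]
    nlinarith
  linarith [hN k hk.le]

theorem tendsto_quadForm_mulOp {V : E → ℝ} (hV : IsSymbol (-1) fun x => (V x : ℂ))
    (hV0 : ∀ x, 0 ≤ V x) {f : ℕ → 𝓢(E, ℂ)} {C D : ℝ} (hf : ∀ k, normL2 (f k) ^ 2 ≤ C)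
    (hf' : ∀ k, quadForm (-lapOp E) (f k) ≤ D)
    (h0 : ∀ ψ, Tendsto (fun k => inner ℂ (toL2 E (f k)) (toL2 E ψ)) atTop (𝓝 0)) :
    Tendsto (fun k => quadForm (mulOp fun x => (V x : ℂ)) (f k)) atTop (𝓝 0) := by
  have hV' := hV.hasTemperateGrowth
  have hq0 : ∀ f, 0 ≤ quadForm (mulOp fun x => (V x : ℂ)) f := fun f => by
    rw [quadForm_mulOp hV']
    exact integral_nonneg fun x => mul_nonneg (hV0 x) (sq_nonneg _)
  obtain ⟨B, hB⟩ : ∃ B, ∀ x, V x ≤ B := by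
    obtain ⟨B, hB⟩ := (hV.mono (m' := 0) (by norm_num)).norm_le
    exact ⟨B, fun x => (le_abs_self _).trans (by simpa using hB x)⟩
  have hB0 : 0 ≤ B := (hV0 0).trans (hB 0)
  rw [Metric.tendsto_atTop']
  intro ε hε
  have hδ : 0 < ε / (4 * B * |D| + 1) := by positivity
  obtain ⟨G, hG, hG', hG1, hGδ⟩ := exists_frequency_cutoff (E := E) hδ
  have hGt : (fun ξ => (G ξ : ℂ)).HasTemperateGrowth :=
    ((hG.comp_left (g := Complex.ofReal) rfl).toSchwartzMap
      (Complex.ofRealCLM.contDiff.comp hG')).hasTemperateGrowth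
  have h1 := tendsto_quadForm_mulOp_fourierOp hV hV0 hG hG' hf h0
  obtain ⟨N, hN⟩ := Filter.eventually_atTop.1 (h1.eventually_lt_const (by positivity : 0 < ε / 4))
  refine ⟨N, fun k hk => ?_⟩
  rw [Real.dist_0_eq_abs, abs_of_nonneg (hq0 _)]
  have h2 := quadForm_add_apply_le hq0 (fourierOp (fun ξ => (G ξ : ℂ)) (f k))
    (f k - fourierOp (fun ξ => (G ξ : ℂ)) (f k))
  rw [add_sub_cancel] at h2
  have h3 := hN k hk.le
  have h4 := (quadForm_mulOp_le hV' hB (f k - fourierOp (fun ξ => (G ξ : ℂ)) (f k))).trans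
    (mul_le_mul_of_nonneg_left (normL2_sub_fourierOp_sq_le hGt hGδ (f k)) hB0)
  have h5 : B * (ε / (4 * B * |D| + 1) * quadForm (-lapOp E) (f k)) ≤ ε / 4 := by
    calc _ ≤ B * (ε / (4 * B * |D| + 1) * |D|) := by
          gcongr; exact (hf' k).trans (le_abs_self D)
      _ ≤ ε / 4 := by
          rw [div_mul_eq_mul_div, ← mul_div_assoc, div_le_iff₀ (by positivity)]
          nlinarith [abs_nonneg D]
  linarith

end Compactness

section GroundState

open scoped ContDiff SchwartzMap Topology ComplexConjugate
open SchwartzMap Filter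

set_option linter.unusedSectionVars false

variable {E : Type*} [NormedAddCommGroup E] [InnerProductSpace ℝ E] [FiniteDimensional ℝ E]
  [MeasurableSpace E] [BorelSpace E]

theorem schrodinger_add {V U : E → ℝ} (hV : (fun x => (V x : ℂ)).HasTemperateGrowth)
    (hU : (fun x => (U x : ℂ)).HasTemperateGrowth) :
    schrodinger (fun x => V x + U x) = schrodinger V - mulOp fun x => (U x : ℂ) := by
  have h : (mulOp fun x => ((V x + U x : ℝ) : ℂ)) =
      (mulOp fun x => (V x : ℂ)) + mulOp fun x => (U x : ℂ) := by
    simp only [Complex.ofReal_add]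
    exact smulLeftCLM_add hV hU
  rw [schrodinger, schrodinger, h, sub_sub]

theorem eq_zero_of_toL2_eq_zero {f : 𝓢(E, ℂ)} (h : toL2 E f = 0) : f = 0 :=
  SchwartzMap.injective_toLp (p := 2) (μ := (volume : Measure E)) (by
    rw [← map_zero (toL2 E)] at h; exact h)

/-- If `-Δ - V` is nonnegative and `-Δ - (V + U)` has a negative direction in the range of
`-Δ - V`, then the product of the two operators has a negative eigenvalue with a Schwartz
eigenfunction. -/
theorem exists_schrodinger_eigenfunction {V U : E → ℝ} (hV : IsSymbol (-1) fun x => (V x : ℂ))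
    (hU : IsSymbol (-1) fun x => (U x : ℂ)) (hU0 : ∀ x, 0 ≤ U x)
    (hL0 : ∀ f, 0 ≤ quadForm (schrodinger V) f)
    (hneg : ∃ φ, quadForm (schrodinger fun x => V x + U x) (schrodinger V φ) < 0) :
    ∃ m : ℝ, 0 < m ∧ ∃ g : 𝓢(E, ℂ), g ≠ 0 ∧
      schrodinger V (schrodinger (fun x => V x + U x) g) + (m : ℂ) • g = 0 := by
  have hV' := hV.hasTemperateGrowth
  have hU' := hU.hasTemperateGrowth
  have hbound : ∀ {W : E → ℝ}, IsSymbol (-1) (fun x => (W x : ℂ)) → ∃ B, 0 ≤ B ∧ ∀ x, W x ≤ B :=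
    fun hW => by
      obtain ⟨B, hB⟩ := (hW.mono (m' := 0) (by norm_num)).norm_le
      have hB' : ∀ x, |_| ≤ B := fun x => by simpa using hB x
      exact ⟨B, (abs_nonneg _).trans (hB' 0), fun x => (le_abs_self _).trans (hB' x)⟩
  obtain ⟨C, hC, hUC⟩ := hbound hU
  obtain ⟨B, hB, hVB⟩ := hbound hV
  have hL := AdjointPair.schrodinger hV'
  have hM := AdjointPair.mulOp_ofReal hU'
  have hsym : IsSymbol (-1) (fun x => ((V x + U x : ℝ) : ℂ)) := by
    simp only [Complex.ofReal_add]
    exact hV.add hU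
  have hP := schrodinger_add hV' hU'
  have hLP := AdjointPair.schrodinger hsym.hasTemperateGrowth
  rw [hP] at hneg
  obtain ⟨m, hm, f, hf1, hf2, hf3, hf4⟩ := exists_minimizing_sequence hL hM hL0 hC
    (quadForm_mulOp_le hU' hUC) hneg
  rw [← hP] at hf4
  have : Fact ((2 : ℝ≥0∞) ≠ ⊤) := ⟨by norm_num⟩
  obtain ⟨u, φ, hφ, hu⟩ := exists_weakly_convergent_subseq (x := fun k => toL2 E (f k))
    (C := Real.sqrt C) fun k => by
      rw [← normL2_eq]
      exact Real.le_sqrt_of_sq_le (hf1 k)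
  have hu0 : ∀ ψ, inner ℂ u (toL2 E (schrodinger (fun x => V x + U x) (schrodinger V ψ) +
      (m : ℂ) • ψ)) = 0 := fun ψ =>
    tendsto_nhds_unique (hu _) ((hf4 ψ).comp hφ.tendsto_atTop)
  obtain ⟨g, rfl⟩ := exists_toL2_eq_of_schrodinger hsym hV hm hu0
  refine ⟨m, hm, g, ?_, ?_⟩
  · rintro rfl
    rw [map_zero] at hu
    simp only [inner_zero_left] at hu
    have h := tendsto_quadForm_mulOp hU hU0 (f := fun k => f (φ k)) (C := C)
      (D := C ^ 2 + B * C) (fun k => hf1 _) (fun k => by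
        have h1 := hf2 (φ k)
        rw [schrodinger, quadForm_sub] at h1
        have h2 := (quadForm_mulOp_le hV' hVB (f (φ k))).trans
          (mul_le_mul_of_nonneg_left (hf1 (φ k)) hB)
        linarith) (fun ψ => hu _)
    have h2 := ge_of_tendsto' h fun k => hf3 (φ k)
    linarith
  · refine eq_zero_of_toL2_eq_zero (inner_self_eq_zero (𝕜 := ℂ).1 ?_)
    set ψ := schrodinger V (schrodinger (fun x => V x + U x) g) + (m : ℂ) • g with hψ
    have h := hu0 ψ
    rw [map_add, inner_add_right, ← hLP, ← hL, map_smul, inner_smul_right] at h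
    nth_rw 1 [hψ]
    rw [map_add, inner_add_left, map_smul, inner_smul_left, Complex.conj_ofReal]
    exact h

end GroundState

section Positivity

open scoped ContDiff SchwartzMap LineDeriv
open SchwartzMap LineDeriv

set_option linter.unusedSectionVars false

variable {E : Type*} [NormedAddCommGroup E] [InnerProductSpace ℝ E] [FiniteDimensional ℝ E]
  [MeasurableSpace E] [BorelSpace E]

theorem normL2_sq_eq_integral (f : 𝓢(E, ℂ)) : normL2 f ^ 2 = ∫ x, ‖f x‖ ^ 2 := by
  rw [← quadForm_one, quadForm, inner_toL2, ← Complex.ofReal_re (∫ x, _),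
    ← integral_complex_ofReal]
  congr 2 with x
  rw [RCLike.inner_apply]
  exact (Complex.mul_conj _).trans (by rw [Complex.normSq_eq_norm_sq])

theorem fderiv_ofReal_apply {f : E → ℝ} {f' : E →L[ℝ] ℝ} {x : E} (hf : HasFDerivAt f f' x) (v : E) :
    fderiv ℝ (fun y => (f y : ℂ)) x v = (f' v : ℝ) := by
  have h : HasFDerivAt (fun y => (f y : ℂ)) (Complex.ofRealCLM.comp f') x :=
    Complex.ofRealCLM.hasFDerivAt.comp x hf
  rw [h.fderiv]
  rfl

/-- The ground state in dimension `d` is a power of `rho d`. -/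
def rho (d : ℕ) (x : E) : ℝ := 1 + ‖x‖ ^ 2 / ((d : ℝ) * ((d : ℝ) - 2))

/-- The logarithmic derivative of the ground state in the direction `v`. -/
def drift (d : ℕ) (v x : E) : ℝ := -(inner ℝ x v / d) * (rho d x)⁻¹

variable {d : ℕ}

theorem one_le_rho (hd : 2 < d) (x : E) : 1 ≤ rho d x := by
  have : (2 : ℝ) < d := by exact_mod_cast hd
  have : 0 < (d : ℝ) * ((d : ℝ) - 2) := mul_pos (by linarith) (by linarith)
  exact le_add_of_nonneg_right (by positivity)

theorem rho_pos (hd : 2 < d) (x : E) : 0 < rho d x := one_pos.trans_le (one_le_rho hd x)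

theorem hasFDerivAt_rho (d : ℕ) (x : E) :
    HasFDerivAt (rho d) ((2 / ((d : ℝ) * ((d : ℝ) - 2))) • innerSL ℝ x) x := by
  have h := (((hasStrictFDerivAt_norm_sq x).hasFDerivAt).mul_const
    ((d : ℝ) * ((d : ℝ) - 2))⁻¹).const_add 1
  refine h.congr_fderiv ?_
  ext v
  simp only [_root_.smul_apply, nsmul_eq_mul, smul_eq_mul, div_eq_inv_mul, Nat.cast_ofNat]
  ring

theorem contDiff_rho (d : ℕ) : ContDiff ℝ ∞ (rho d : E → ℝ) :=
  contDiff_const.add ((contDiff_norm_sq ℝ).div_const _)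

theorem hasFDerivAt_inner_left (x v : E) :
    HasFDerivAt (fun y : E => inner ℝ y v) (innerSL ℝ v) x := by
  have h := (innerSL ℝ v).hasFDerivAt (x := x)
  refine h.congr_of_eventuallyEq (.of_forall fun y => ?_)
  simp [real_inner_comm]

theorem hasFDerivAt_drift (hd : 2 < d) (v x : E) : HasFDerivAt (drift d v)
    (-(inner ℝ x v / d) • (-(rho d x ^ 2)⁻¹ • (2 / ((d : ℝ) * ((d : ℝ) - 2))) • innerSL ℝ x) +
      (rho d x)⁻¹ • -((d : ℝ)⁻¹ • innerSL ℝ v)) x := by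
  have h := ((hasFDerivAt_inner_left x v).mul_const (d : ℝ)⁻¹).neg.mul
    ((hasDerivAt_inv (rho_pos hd x).ne').comp_hasFDerivAt x (hasFDerivAt_rho d x))
  exact h

theorem isSymbol_inv_rho (hd : 2 < d) : IsSymbol (-2) fun x : E => (((rho d x)⁻¹ : ℝ) : ℂ) := by
  have h2 : (2 : ℝ) < d := by exact_mod_cast hd
  have hθ : 0 < (d : ℝ) * ((d : ℝ) - 2) := mul_pos (by linarith) (by linarith)
  set θ := (d : ℝ) * ((d : ℝ) - 2) with hθ'
  have h : IsSymbol 2 fun x : E => (rho d x : ℂ) := by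
    have h := ((IsSymbol.const (E := E) (1 : ℂ)).mono (m' := 2) (by norm_num)).add
      (isSymbol_norm_sq.const_mul ((θ⁻¹ : ℝ) : ℂ))
    refine (congrArg _ ?_).mp h
    ext x
    rw [rho, div_eq_inv_mul, ← hθ']
    push_cast
    rfl
  have h3 := h.inv (c := (2 * (1 + θ))⁻¹) (by positivity) fun x => by
    rw [Complex.norm_real, Real.norm_of_nonneg (rho_pos hd x).le, inv_mul_le_iff₀ (by positivity),
      rho, show (2 : ℤ) = (2 : ℕ) from rfl, zpow_natCast]
    have h4 : 2 * (1 + θ) * (1 + ‖x‖ ^ 2 / θ) =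
      2 * (1 + ‖x‖ ^ 2) + 2 * θ + 2 * (‖x‖ ^ 2 / θ) := by field_simp; ring
    rw [h4]
    have : 0 ≤ ‖x‖ ^ 2 / θ := by positivity
    nlinarith [sq_nonneg (1 - ‖x‖)]
  simpa only [Complex.ofReal_inv] using h3

theorem isSymbol_drift (hd : 2 < d) (v : E) : IsSymbol (-1) fun x => (drift d v x : ℂ) := by
  have h := ((isSymbol_coord v).const_mul (((-(d : ℝ)⁻¹ : ℝ)) : ℂ)).mul
    (isSymbol_inv_rho (E := E) hd)
  refine (congrArg _ ?_).mp h
  ext x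
  rw [drift]
  push_cast
  ring

theorem isSymbol_inv_rho_sq (hd : 2 < d) :
    IsSymbol (-1) fun x : E => ((((rho d x)⁻¹ ^ 2 : ℝ)) : ℂ) := by
  have h := ((isSymbol_inv_rho (E := E) hd).pow 2).mono (m' := -1) (by norm_num)
  simpa only [Complex.ofReal_pow] using h

/-- The derivative in the direction `v`, conjugated by the ground state. -/
def twistedDeriv (d : ℕ) (v : E) : 𝓢(E, ℂ) →L[ℂ] 𝓢(E, ℂ) :=
  derivOp v - mulOp fun x => (drift d v x : ℂ)

/-- The formal adjoint of `-twistedDeriv d v`. -/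
def twistedDeriv' (d : ℕ) (v : E) : 𝓢(E, ℂ) →L[ℂ] 𝓢(E, ℂ) :=
  derivOp v + mulOp fun x => (drift d v x : ℂ)

theorem adjointPair_twistedDeriv (hd : 2 < d) (v : E) :
    AdjointPair (twistedDeriv d v) (-twistedDeriv' d v) := by
  rw [twistedDeriv', neg_add]
  exact (AdjointPair.derivOp v).sub (.mulOp_ofReal (isSymbol_drift hd v).hasTemperateGrowth)

theorem sum_drift (hd : 2 < d) (b : OrthonormalBasis (Fin d) ℝ E) (x : E) :
    ∑ i, ((-(inner ℝ x (b i) / d) * (-(rho d x ^ 2)⁻¹ * (2 / ((d : ℝ) * ((d : ℝ) - 2)) *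
      inner ℝ x (b i))) + (rho d x)⁻¹ * -((d : ℝ)⁻¹ * inner ℝ (b i) (b i))) +
      drift d (b i) x ^ 2) = -((rho d x)⁻¹ ^ 2) := by
  have h2 : (2 : ℝ) < d := by exact_mod_cast hd
  have hρ := rho_pos hd x
  have h3 : ∀ i, ((-(inner ℝ x (b i) / d) * (-(rho d x ^ 2)⁻¹ * (2 / ((d : ℝ) * ((d : ℝ) - 2)) *
      inner ℝ x (b i))) + (rho d x)⁻¹ * -((d : ℝ)⁻¹ * inner ℝ (b i) (b i))) +
      drift d (b i) x ^ 2) =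
      (rho d x ^ 2)⁻¹ * ((d : ℝ) * ((d : ℝ) - 2))⁻¹ * inner ℝ x (b i) ^ 2 -
        (rho d x)⁻¹ * (d : ℝ)⁻¹ := fun i => by
    rw [real_inner_self_eq_norm_sq, b.norm_eq_one, drift]
    have : (d : ℝ) - 2 ≠ 0 := by linarith
    have : (d : ℝ) ≠ 0 := by linarith
    field_simp
    ring
  simp_rw [h3]
  rw [Finset.sum_sub_distrib, ← Finset.mul_sum, b.sum_sq_inner_left, Finset.sum_const,
    Finset.card_univ, Fintype.card_fin, nsmul_eq_mul]
  have h4 : ‖x‖ ^ 2 = (rho d x - 1) * ((d : ℝ) * ((d : ℝ) - 2)) := by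
    have : (d : ℝ) - 2 ≠ 0 := by linarith
    rw [rho]
    field_simp
    ring
  rw [h4]
  have : (d : ℝ) - 2 ≠ 0 := by linarith
  field_simp
  ring

theorem schrodinger_eq_sum (hd : 2 < d) (b : OrthonormalBasis (Fin d) ℝ E) :
    schrodinger (fun x : E => (rho d x)⁻¹ ^ 2) =
      ∑ i, -twistedDeriv' d (b i) * twistedDeriv d (b i) := by
  have h1 : ∀ i, -twistedDeriv' d (b i) * twistedDeriv d (b i) = -(derivOp (b i) * derivOp (b i)) +
      ((mulOp fun x => fderiv ℝ (fun x => (drift d (b i) x : ℂ)) x (b i)) +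
      mulOp fun x => (drift d (b i) x : ℂ) * (drift d (b i) x : ℂ)) := fun i => by
    have hs := isSymbol_drift (E := E) hd (b i)
    have h := derivOp_mul_mulOp hs (b i)
    rw [← mulOp_mul hs.hasTemperateGrowth hs.hasTemperateGrowth, twistedDeriv, twistedDeriv',
      neg_mul, add_mul, mul_sub, mul_sub, h]
    abel
  have h2 : (mulOp fun x : E => (((rho d x)⁻¹ ^ 2 : ℝ) : ℂ)) =
      -∑ i, ((mulOp fun x => fderiv ℝ (fun x => (drift d (b i) x : ℂ)) x (b i)) +
      mulOp fun x => (drift d (b i) x : ℂ) * (drift d (b i) x : ℂ)) := by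
    ext f x
    rw [smulLeftCLM_apply_apply (isSymbol_inv_rho_sq hd).hasTemperateGrowth, _root_.neg_apply,
      _root_.neg_apply, _root_.sum_apply, _root_.sum_apply, ← neg_neg ((rho d x)⁻¹ ^ 2),
      ← sum_drift hd b x, Complex.ofReal_neg, neg_smul, Complex.ofReal_sum, Finset.sum_smul]
    congr 1
    refine Finset.sum_congr rfl fun i _ => ?_
    have hs := isSymbol_drift (E := E) hd (b i)
    rw [_root_.add_apply, _root_.add_apply,
      smulLeftCLM_apply_apply (hs.fderiv_apply (b i)).hasTemperateGrowth,
      smulLeftCLM_apply_apply (hs.mul hs).hasTemperateGrowth,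
      fderiv_ofReal_apply (hasFDerivAt_drift hd (b i) x), ← add_smul]
    congr 1
    rw [sq (drift d (b i) x), Complex.ofReal_add, Complex.ofReal_mul (drift d (b i) x)]
    rfl
  rw [schrodinger, h2, lapOp_eq_sum b, Finset.sum_congr rfl fun i _ => h1 i,
    sub_neg_eq_add, ← Finset.sum_neg_distrib, ← Finset.sum_add_distrib]

theorem quadForm_schrodinger_eq_sum (hd : 2 < d) (b : OrthonormalBasis (Fin d) ℝ E) (f : 𝓢(E, ℂ)) :
    quadForm (schrodinger fun x : E => (rho d x)⁻¹ ^ 2) f =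
      ∑ i, normL2 (twistedDeriv d (b i) f) ^ 2 := by
  rw [schrodinger_eq_sum hd b, quadForm, _root_.sum_apply, map_sum, sum_inner, Complex.re_sum]
  refine Finset.sum_congr rfl fun i _ => ?_
  rw [← quadForm_one, quadForm, ← inner_conj_symm, Complex.conj_re, mul_apply_eq_comp,
    ← adjointPair_twistedDeriv hd]
  rfl

end Positivity

section Integrals

open scoped ContDiff
open Module

set_option linter.unusedSectionVars false

variable {E : Type*} [NormedAddCommGroup E] [InnerProductSpace ℝ E] [FiniteDimensional ℝ E]
  [MeasurableSpace E] [BorelSpace E] {d : ℕ}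

theorem inv_rho_pos (hd : 2 < d) (x : E) : 0 < (rho d x)⁻¹ := inv_pos.2 (rho_pos hd x)

theorem inv_rho_le_one (hd : 2 < d) (x : E) : (rho d x)⁻¹ ≤ 1 :=
  inv_le_one_of_one_le₀ (one_le_rho hd x)

theorem continuous_inv_rho (hd : 2 < d) : Continuous fun x : E => (rho d x)⁻¹ :=
  (contDiff_rho d).continuous.inv₀ fun x => (rho_pos hd x).ne'

theorem dim_pos (hd : 2 < d) : 0 < (d : ℝ) * ((d : ℝ) - 2) := by
  have h2 : (2 : ℝ) < d := by exact_mod_cast hd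
  exact mul_pos (by linarith) (by linarith)

theorem norm_sq_eq_rho (hd : 2 < d) (x : E) :
    ‖x‖ ^ 2 = (rho d x - 1) * ((d : ℝ) * ((d : ℝ) - 2)) := by
  rw [rho, add_sub_cancel_left, div_mul_cancel₀ _ (dim_pos hd).ne']

theorem integrable_inv_rho_pow (hd : 2 < d) {n : ℕ} (hn : finrank ℝ E < 2 * n) :
    Integrable fun x : E => (rho d x)⁻¹ ^ n := by
  have hθ := dim_pos hd
  set θ := (d : ℝ) * ((d : ℝ) - 2) with hθ'
  have h := integrable_rpow_neg_one_add_norm_sq (μ := (volume : Measure E)) (r := 2 * n)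
    (by exact_mod_cast hn)
  refine (h.const_mul ((1 + θ) ^ n)).mono' ((continuous_inv_rho hd).pow n).aestronglyMeasurable
    (.of_forall fun x => ?_)
  rw [Real.norm_of_nonneg (pow_nonneg (inv_rho_pos hd x).le n), neg_div,
    mul_div_cancel_left₀ _ (two_ne_zero' ℝ), Real.rpow_neg (by positivity), Real.rpow_natCast,
    ← inv_pow, ← mul_pow]
  refine pow_le_pow_left₀ (inv_rho_pos hd x).le ?_ n
  rw [← div_eq_mul_inv, inv_eq_one_div, div_le_div_iff₀ (rho_pos hd x) (by positivity), one_mul,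
    norm_sq_eq_rho hd x, ← hθ']
  nlinarith [one_le_rho hd x]

theorem hasFDerivAt_inv_rho_pow (hd : 2 < d) (n : ℕ) (x : E) :
    HasFDerivAt (fun y : E => (rho d y)⁻¹ ^ n)
      ((-(n * (rho d x)⁻¹ ^ (n + 1) * (2 / ((d : ℝ) * ((d : ℝ) - 2))))) • innerSL ℝ x) x := by
  have h := ((hasDerivAt_inv (rho_pos hd x).ne').comp_hasFDerivAt x (hasFDerivAt_rho d x)).pow n
  refine h.congr_fderiv ?_
  ext v
  simp only [_root_.smul_apply, nsmul_eq_mul, smul_eq_mul, Function.comp_apply]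
  rcases n with _ | n
  · simp
  · rw [Nat.add_sub_cancel, ← inv_pow]
    ring

theorem integral_inv_rho_pow_succ (hd : 2 < d) (b : OrthonormalBasis (Fin d) ℝ E) {n : ℕ}
    (hn : d ≤ n) :
    2 * (n : ℝ) * ∫ x : E, (rho d x)⁻¹ ^ (n + 1) = (2 * n - d) * ∫ x : E, (rho d x)⁻¹ ^ n := by
  have hE : finrank ℝ E = d := by rw [finrank_eq_card_basis b.toBasis, Fintype.card_fin]
  have hθ := dim_pos hd
  set θ := (d : ℝ) * ((d : ℝ) - 2) with hθ'
  have hi : ∀ {m : ℕ}, d < 2 * m → Integrable fun x : E => (rho d x)⁻¹ ^ m := fun hm =>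
    integrable_inv_rho_pow hd (hE ▸ hm)
  have hc : ∀ i, Continuous fun x : E => (inner ℝ x (b i) : ℝ) := fun i => by fun_prop
  have hle : ∀ i (x : E), (inner ℝ x (b i) : ℝ) ^ 2 ≤ ‖x‖ ^ 2 := fun i x => by
    have := abs_real_inner_le_norm x (b i)
    rw [b.norm_eq_one, mul_one] at this
    rw [← sq_abs]
    gcongr
  have hσ := fun x : E => inv_rho_pos hd x
  have hρσ : ∀ x : E, rho d x * (rho d x)⁻¹ = 1 := fun x => mul_inv_cancel₀ (rho_pos hd x).ne'
  have hi2 : ∀ i, Integrable fun x : E => (rho d x)⁻¹ ^ (n + 1) * (inner ℝ x (b i) : ℝ) ^ 2 :=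
    fun i => by
    refine ((hi (m := n) (by lia)).const_mul θ).mono'
      (((continuous_inv_rho hd).pow _).mul ((hc i).pow 2)).aestronglyMeasurable
      (.of_forall fun x => ?_)
    rw [Real.norm_of_nonneg (mul_nonneg (pow_nonneg (hσ x).le _) (sq_nonneg _))]
    calc _ ≤ (rho d x)⁻¹ ^ (n + 1) * (rho d x * θ) := by
          gcongr
          · exact pow_nonneg (hσ x).le _
          · refine (hle i x).trans ?_
            rw [norm_sq_eq_rho hd x]
            gcongr
            linarith
      _ = θ * (rho d x)⁻¹ ^ n * (rho d x * (rho d x)⁻¹) := by ring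
      _ = _ := by rw [hρσ, mul_one]
  have hparts : ∀ i, ∫ x : E, (rho d x)⁻¹ ^ n =
      (n * (2 / θ)) * ∫ x : E, (rho d x)⁻¹ ^ (n + 1) * (inner ℝ x (b i) : ℝ) ^ 2 := fun i => by
    have hf : ∀ x : E, fderiv ℝ (fun y : E => (inner ℝ y (b i) : ℝ)) x (b i) = 1 := fun x => by
      rw [(hasFDerivAt_inner_left x (b i)).fderiv, innerSL_apply_apply, real_inner_self_eq_norm_sq,
        b.norm_eq_one, one_pow]
    have hg : ∀ x : E, (inner ℝ x (b i) : ℝ) * fderiv ℝ (fun y : E => (rho d y)⁻¹ ^ n) x (b i) =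
        -(n * (2 / θ)) * ((rho d x)⁻¹ ^ (n + 1) * (inner ℝ x (b i) : ℝ) ^ 2) := fun x => by
      rw [(hasFDerivAt_inv_rho_pow hd n x).fderiv, _root_.smul_apply, innerSL_apply_apply,
        smul_eq_mul]
      ring
    have h := integral_mul_fderiv_eq_neg_fderiv_mul_of_integrable (μ := (volume : Measure E))
      (f := fun y : E => (inner ℝ y (b i) : ℝ)) (g := fun y : E => (rho d y)⁻¹ ^ n) (v := b i)
      (by simp_rw [hf, one_mul]; exact hi (by lia))
      (by simp_rw [hg]; exact (hi2 i).const_mul _)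
      (by
        refine ((hi (m := n - 1) (by lia)).const_mul (1 + θ)).mono'
          ((hc i).mul ((continuous_inv_rho hd).pow _)).aestronglyMeasurable
          (.of_forall fun x => ?_)
        rw [norm_mul, Real.norm_of_nonneg (pow_nonneg (hσ x).le _), Real.norm_eq_abs]
        obtain ⟨k, rfl⟩ : ∃ k, n = k + 1 := ⟨n - 1, by lia⟩
        have h1 : |(inner ℝ x (b i) : ℝ)| ≤ (1 + θ) * rho d x := by
          refine abs_le_of_sq_le_sq ?_ (mul_nonneg (by positivity) (rho_pos hd x).le)
          refine (hle i x).trans ?_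
          rw [norm_sq_eq_rho hd x]
          have h1 := one_le_rho hd x
          have h2 : rho d x ≤ rho d x ^ 2 := by nlinarith
          nlinarith [mul_le_mul_of_nonneg_left h2 hθ.le,
            mul_nonneg (sq_nonneg θ) (sq_nonneg (rho d x)),
            mul_nonneg hθ.le (sq_nonneg (rho d x)), sq_nonneg (rho d x)]
        calc _ ≤ (1 + θ) * rho d x * (rho d x)⁻¹ ^ (k + 1) :=
              mul_le_mul_of_nonneg_right h1 (pow_nonneg (hσ x).le _)
          _ = (1 + θ) * (rho d x)⁻¹ ^ k * (rho d x * (rho d x)⁻¹) := by ring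
          _ = _ := by rw [hρσ, mul_one]; rfl)
      (fun x _ => (hasFDerivAt_inner_left x (b i)).differentiableAt)
      (fun x _ => (hasFDerivAt_inv_rho_pow hd n x).differentiableAt)
    simp_rw [hf, hg, one_mul] at h
    rw [integral_const_mul] at h
    linarith
  have h1 : ∑ i, ∫ x : E, (rho d x)⁻¹ ^ (n + 1) * (inner ℝ x (b i) : ℝ) ^ 2 =
      θ * ((∫ x : E, (rho d x)⁻¹ ^ n) - ∫ x : E, (rho d x)⁻¹ ^ (n + 1)) := by
    rw [← integral_finsetSum _ fun i _ => hi2 i, ← integral_sub (hi (by lia)) (hi (by lia)),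
      ← integral_const_mul]
    congr 1 with x
    rw [← Finset.mul_sum, b.sum_sq_inner_left, norm_sq_eq_rho hd x, ← hθ']
    linear_combination θ * (rho d x)⁻¹ ^ n * hρσ x
  have h2 := Finset.sum_congr (rfl : (Finset.univ : Finset (Fin d)) = _) fun i _ => hparts i
  rw [Finset.sum_const, ← Finset.mul_sum, h1, Finset.card_univ, Fintype.card_fin,
    nsmul_eq_mul] at h2
  have h3 : (n : ℝ) * (2 / θ) *
      (θ * ((∫ x : E, (rho d x)⁻¹ ^ n) - ∫ x : E, (rho d x)⁻¹ ^ (n + 1))) =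
      2 * n * ((∫ x : E, (rho d x)⁻¹ ^ n) - ∫ x : E, (rho d x)⁻¹ ^ (n + 1)) := by
    field_simp
  rw [h3] at h2
  linarith

/-- The limiting value of the quadratic form along the truncated test functions is negative. -/
theorem integral_limit_neg (hd : 2 < d) (b : OrthonormalBasis (Fin d) ℝ E) :
    ∫ x : E, (rho d x)⁻¹ ^ (d - 2) * ((rho d x - 1) *
      (-(4 * ((d : ℝ) - 2)) * (rho d x)⁻¹ ^ 2) ^ 2 / d -
      (rho d x)⁻¹ ^ 2 * (2 * d - 4 * ((d : ℝ) - 2) * (1 - (rho d x)⁻¹)) ^ 2) < 0 := by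
  have hE : finrank ℝ E = d := by rw [finrank_eq_card_basis b.toBasis, Fintype.card_fin]
  have hi : ∀ {m : ℕ}, d < 2 * m → Integrable fun x : E => (rho d x)⁻¹ ^ m := fun hm =>
    integrable_inv_rho_pow hd (hE ▸ hm)
  have hd0 : (d : ℝ) ≠ 0 := by positivity
  have h1 : ∀ x : E, (rho d x)⁻¹ ^ (d - 2) * ((rho d x - 1) *
      (-(4 * ((d : ℝ) - 2)) * (rho d x)⁻¹ ^ 2) ^ 2 / d -
      (rho d x)⁻¹ ^ 2 * (2 * d - 4 * ((d : ℝ) - 2) * (1 - (rho d x)⁻¹)) ^ 2) =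
      -(8 - 2 * d) ^ 2 * (rho d x)⁻¹ ^ d +
      (16 * ((d : ℝ) - 2) ^ 2 / d - 8 * (8 - 2 * d) * (d - 2)) * (rho d x)⁻¹ ^ (d + 1) +
      (-(16 * ((d : ℝ) - 2) ^ 2 / d) - 16 * (d - 2) ^ 2) * (rho d x)⁻¹ ^ (d + 2) := fun x => by
    have h2 : (rho d x)⁻¹ ^ d = (rho d x)⁻¹ ^ (d - 2) * (rho d x)⁻¹ ^ 2 := by
      rw [← pow_add]; congr 1; lia
    rw [pow_add _ d 1, pow_add _ d 2, h2]
    have hρσ : rho d x * (rho d x)⁻¹ = 1 := mul_inv_cancel₀ (rho_pos hd x).ne'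
    linear_combination (rho d x)⁻¹ ^ (d - 2) * (16 * ((d : ℝ) - 2) ^ 2 / d) * (rho d x)⁻¹ ^ 3 * hρσ
  simp_rw [h1]
  have hi2 : ∀ a c : ℝ, Integrable fun x : E =>
      a * (rho d x)⁻¹ ^ d + c * (rho d x)⁻¹ ^ (d + 1) := fun a c =>
    ((hi (by lia)).const_mul a).add ((hi (by lia)).const_mul c)
  rw [integral_add (hi2 _ _) ((hi (by lia)).const_mul _), integral_add ((hi (by lia)).const_mul _)
    ((hi (by lia)).const_mul _), integral_const_mul, integral_const_mul, integral_const_mul]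
  have h2 := integral_inv_rho_pow_succ hd b (n := d) le_rfl
  have h3 := integral_inv_rho_pow_succ hd b (n := d + 1) (by lia)
  have h4 : 0 < ∫ x : E, (rho d x)⁻¹ ^ d := by
    refine integral_pos_of_integrable_nonneg_nonzero (x := 0) ((continuous_inv_rho hd).pow d)
      (hi (by lia)) (fun x => (pow_pos (inv_rho_pos hd x) d).le) (pow_pos (inv_rho_pos hd _) d).ne'
  push_cast at h3
  rw [add_assoc, one_add_one_eq_two] at h3
  set I := ∫ x : E, (rho d x)⁻¹ ^ d
  have h5 : ∫ x : E, (rho d x)⁻¹ ^ (d + 1) = I / 2 := by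
    have : 2 * (d : ℝ) * ((∫ x : E, (rho d x)⁻¹ ^ (d + 1)) - I / 2) = 0 := by linarith
    have := (mul_eq_zero.1 this).resolve_left (by positivity)
    linarith
  rw [h5] at h3 ⊢
  have h6 : ∫ x : E, (rho d x)⁻¹ ^ (d + 2) = (d + 2) / (4 * (d + 1)) * I := by
    rw [div_mul_eq_mul_div, eq_div_iff (by positivity)]
    linarith
  rw [h6]
  have h7 : -(8 - 2 * (d : ℝ)) ^ 2 * I +
      (16 * ((d : ℝ) - 2) ^ 2 / d - 8 * (8 - 2 * d) * (d - 2)) * (I / 2) +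
      (-(16 * ((d : ℝ) - 2) ^ 2 / d) - 16 * (d - 2) ^ 2) * ((d + 2) / (4 * (d + 1)) * I) =
      -16 * I := by
    field_simp
    ring
  rw [h7]
  linarith

end Integrals

section NegativeDirection

open scoped ContDiff SchwartzMap LineDeriv Topology
open SchwartzMap LineDeriv Module Filter

set_option linter.unusedSectionVars false

variable {E : Type*} [NormedAddCommGroup E] [InnerProductSpace ℝ E] [FiniteDimensional ℝ E]
  [MeasurableSpace E] [BorelSpace E] {d : ℕ}

/-- The ground state. -/
def bubble (d : ℕ) (x : E) : ℝ := rho d x ^ (-(((d : ℝ) - 2) / 2))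

theorem bubble_sq (hd : 2 < d) (x : E) : bubble d x ^ 2 = (rho d x)⁻¹ ^ (d - 2) := by
  have h := rho_pos hd x
  rw [bubble, ← Real.rpow_natCast, ← Real.rpow_mul h.le, inv_pow, ← Real.rpow_natCast,
    ← Real.rpow_neg h.le, Nat.cast_sub hd.le]
  congr 1
  push_cast
  ring

theorem contDiff_bubble (hd : 2 < d) : ContDiff ℝ ∞ (bubble d : E → ℝ) :=
  (contDiff_rho d).rpow_const_of_ne fun x => (rho_pos hd x).ne'

theorem hasFDerivAt_bubble (hd : 2 < d) (x : E) :
    HasFDerivAt (bubble d) ((-(bubble d x * (rho d x)⁻¹ / d)) • innerSL ℝ x) x := by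
  have h2 : (2 : ℝ) < d := by exact_mod_cast hd
  have h := (hasFDerivAt_rho d x).rpow_const (p := -(((d : ℝ) - 2) / 2)) (.inl (rho_pos hd x).ne')
  refine h.congr_fderiv ?_
  rw [smul_smul]
  congr 1
  rw [Real.rpow_sub_one (rho_pos hd x).ne', bubble]
  have : (d : ℝ) - 2 ≠ 0 := by linarith
  field_simp

theorem fderiv_bubble_mul (hd : 2 < d) {w : E → ℝ} {w' : E →L[ℝ] ℝ} {x : E}
    (hw : HasFDerivAt w w' x) (v : E) :
    fderiv ℝ (fun y => ((bubble d y * w y : ℝ) : ℂ)) x v =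
      ((bubble d x * (w' v + drift d v x * w x) : ℝ) : ℂ) := by
  have h : HasFDerivAt (fun y => bubble d y * w y) _ x := (hasFDerivAt_bubble hd x).mul hw
  rw [fderiv_ofReal_apply h]
  congr 1
  simp only [_root_.add_apply, _root_.smul_apply, innerSL_apply_apply, smul_eq_mul, drift]
  ring

theorem twistedDeriv_apply (hd : 2 < d) {f : 𝓢(E, ℂ)} {w : E → ℝ}
    (hf : ∀ y, f y = ((bubble d y * w y : ℝ) : ℂ)) {w' : E →L[ℝ] ℝ} {x : E}
    (hw : HasFDerivAt w w' x) (v : E) :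
    twistedDeriv d v f x = ((bubble d x * w' v : ℝ) : ℂ) := by
  have h : derivOp v f x = fderiv ℝ f x v := lineDerivOp_apply_eq_fderiv v f x
  rw [twistedDeriv, _root_.sub_apply, _root_.sub_apply, h,
    smulLeftCLM_apply_apply (isSymbol_drift hd v).hasTemperateGrowth, hf x, funext hf,
    fderiv_bubble_mul hd hw, smul_eq_mul]
  push_cast
  ring

theorem twistedDeriv'_apply (hd : 2 < d) {f : 𝓢(E, ℂ)} {w : E → ℝ}
    (hf : ∀ y, f y = ((bubble d y * w y : ℝ) : ℂ)) {w' : E →L[ℝ] ℝ} {x : E}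
    (hw : HasFDerivAt w w' x) (v : E) :
    twistedDeriv' d v f x = ((bubble d x * (w' v + 2 * drift d v x * w x) : ℝ) : ℂ) := by
  have h : derivOp v f x = fderiv ℝ f x v := lineDerivOp_apply_eq_fderiv v f x
  rw [twistedDeriv', _root_.add_apply, _root_.add_apply, h,
    smulLeftCLM_apply_apply (isSymbol_drift hd v).hasTemperateGrowth, hf x, funext hf,
    fderiv_bubble_mul hd hw, smul_eq_mul]
  push_cast
  ring

theorem hasFDerivAt_comp_rho (d : ℕ) {u : ℝ → ℝ} {u' : ℝ} {x : E}
    (hu : HasDerivAt u u' (rho d x)) : HasFDerivAt (fun y : E => u (rho d y))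
      ((u' * (2 / ((d : ℝ) * ((d : ℝ) - 2)))) • innerSL ℝ x) x := by
  rw [mul_smul]
  exact hu.comp_hasFDerivAt x (hasFDerivAt_rho d x)

theorem twistedDeriv_apply_comp_rho (hd : 2 < d) {f : 𝓢(E, ℂ)} {u : ℝ → ℝ}
    (hf : ∀ y, f y = ((bubble d y * u (rho d y) : ℝ) : ℂ)) {u' : ℝ} {x : E}
    (hu : HasDerivAt u u' (rho d x)) (v : E) :
    twistedDeriv d v f x =
      ((bubble d x * (u' * (2 / ((d : ℝ) * ((d : ℝ) - 2))) * inner ℝ x v) : ℝ) : ℂ) :=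
  twistedDeriv_apply hd hf (hasFDerivAt_comp_rho d hu) v

/-- The radial operator obtained by conjugating `-d(d - 2)(-Δ - V)` by the ground state. -/
def radialOp (d : ℕ) (u' u'' : ℝ → ℝ) (t : ℝ) : ℝ :=
  4 * (t - 1) * u'' t + (2 * d - 4 * ((d : ℝ) - 2) * (1 - t⁻¹)) * u' t

theorem schrodinger_apply_comp_rho (hd : 2 < d) (b : OrthonormalBasis (Fin d) ℝ E) {f : 𝓢(E, ℂ)}
    {u u' u'' : ℝ → ℝ} (hf : ∀ y, f y = ((bubble d y * u (rho d y) : ℝ) : ℂ))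
    (hu : ∀ t, HasDerivAt u (u' t) t) (hu' : ∀ t, HasDerivAt u' (u'' t) t) (x : E) :
    schrodinger (fun x : E => (rho d x)⁻¹ ^ 2) f x =
      ((bubble d x * (-((d : ℝ) * ((d : ℝ) - 2))⁻¹ * radialOp d u' u'' (rho d x)) : ℝ) : ℂ) := by
  have hθ := dim_pos hd
  have h2 : (2 : ℝ) < d := by exact_mod_cast hd
  have h1 : ∀ i, (-twistedDeriv' d (b i) * twistedDeriv d (b i)) f x =
      ((-(bubble d x * ((u'' (rho d x) * (2 / ((d : ℝ) * ((d : ℝ) - 2))) ^ 2 -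
        2 * (d : ℝ)⁻¹ * (rho d x)⁻¹ * (u' (rho d x) * (2 / ((d : ℝ) * ((d : ℝ) - 2))))) *
        inner ℝ x (b i) ^ 2 + u' (rho d x) * (2 / ((d : ℝ) * ((d : ℝ) - 2))))) : ℝ) : ℂ) := fun i => by
    have h3 := twistedDeriv'_apply hd
      (fun y => twistedDeriv_apply_comp_rho hd hf (hu (rho d y)) (b i))
      (((hasFDerivAt_comp_rho d (hu' (rho d x))).mul_const (2 / ((d : ℝ) * ((d : ℝ) - 2)))).mul
        (hasFDerivAt_inner_left x (b i))) (b i)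
    rw [mul_apply_eq_comp, _root_.neg_apply, _root_.neg_apply, h3, ← Complex.ofReal_neg]
    congr 2
    simp only [_root_.add_apply, _root_.smul_apply, innerSL_apply_apply, smul_eq_mul, drift,
      real_inner_self_eq_norm_sq, b.norm_eq_one]
    ring
  rw [schrodinger_eq_sum hd b, _root_.sum_apply, _root_.sum_apply,
    Finset.sum_congr rfl fun i _ => h1 i, ← Complex.ofReal_sum, Finset.sum_neg_distrib, ← Finset.mul_sum, Finset.sum_add_distrib,
    ← Finset.mul_sum, b.sum_sq_inner_left, norm_sq_eq_rho hd, Finset.sum_const, Finset.card_univ,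
    Fintype.card_fin, nsmul_eq_mul, radialOp]
  congr 1
  have := rho_pos hd x
  have h3 : (d : ℝ) - 2 ≠ 0 := by linarith
  field_simp
  ring

theorem integrable_norm_sq (f : 𝓢(E, ℂ)) : Integrable fun x => ‖f x‖ ^ 2 := by
  simpa using (f.memLp 2 volume).integrable_norm_pow (by norm_num)

theorem isSymbol_const_mul_inv_rho_sq (hd : 2 < d) (c : ℝ) :
    IsSymbol (-1) fun x : E => ((c * (rho d x)⁻¹ ^ 2 : ℝ) : ℂ) := by
  have h := (isSymbol_inv_rho_sq (E := E) hd).const_mul (c : ℂ)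
  simpa only [Complex.ofReal_mul] using h

theorem quadForm_linearized (hd : 2 < d) (b : OrthonormalBasis (Fin d) ℝ E) {f : 𝓢(E, ℂ)}
    {G G' : ℝ → ℝ} {c : ℝ} (hf : ∀ y, f y = ((bubble d y * (c * G (rho d y)) : ℝ) : ℂ))
    (hG : ∀ t, 1 ≤ t → HasDerivAt G (G' t) t) :
    quadForm (schrodinger fun x : E => (rho d x)⁻¹ ^ 2 + 4 / ((d : ℝ) - 2) * (rho d x)⁻¹ ^ 2) f =
      c ^ 2 * (4 / ((d : ℝ) - 2)) * ∫ x : E, (rho d x)⁻¹ ^ (d - 2) *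
        ((rho d x - 1) * G' (rho d x) ^ 2 / d - (rho d x)⁻¹ ^ 2 * G (rho d x) ^ 2) := by
  have h2 : (2 : ℝ) < d := by exact_mod_cast hd
  have hU := isSymbol_const_mul_inv_rho_sq (E := E) hd (4 / ((d : ℝ) - 2))
  have hUf : Integrable fun x => 4 / ((d : ℝ) - 2) * (rho d x)⁻¹ ^ 2 * ‖f x‖ ^ 2 := by
    refine ((integrable_norm_sq f).const_mul (4 / ((d : ℝ) - 2))).mono'
      ((continuous_const.mul ((continuous_inv_rho hd).pow 2)).mul
        (f.continuous.norm.pow 2)).aestronglyMeasurable (.of_forall fun x => ?_)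
    have h3 : (rho d x)⁻¹ ^ 2 ≤ 1 := pow_le_one₀ (inv_rho_pos hd x).le (inv_rho_le_one hd x)
    have h4 : 0 < 4 / ((d : ℝ) - 2) := div_pos (by norm_num) (by linarith)
    rw [Real.norm_of_nonneg (by positivity)]
    gcongr
    exact mul_le_of_le_one_right h4.le h3
  rw [schrodinger_add (isSymbol_inv_rho_sq hd).hasTemperateGrowth hU.hasTemperateGrowth,
    quadForm_sub, quadForm_schrodinger_eq_sum hd b, quadForm_mulOp hU.hasTemperateGrowth]
  simp_rw [normL2_sq_eq_integral]
  rw [← integral_finsetSum _ fun i _ => integrable_norm_sq _,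
    ← integral_sub (integrable_finsetSum _ fun i _ => integrable_norm_sq _) hUf,
    ← integral_const_mul]
  congr 1 with x
  have h3 : ∀ i, ‖twistedDeriv d (b i) f x‖ ^ 2 =
      bubble d x ^ 2 * (c * G' (rho d x) * (2 / ((d : ℝ) * ((d : ℝ) - 2)))) ^ 2 *
        inner ℝ x (b i) ^ 2 := fun i => by
    rw [twistedDeriv_apply_comp_rho hd (u := fun t => c * G t) hf
      ((hG _ (one_le_rho hd x)).const_mul c), Complex.norm_real, Real.norm_eq_abs, sq_abs]
    ring
  rw [Finset.sum_congr rfl fun i _ => h3 i, ← Finset.mul_sum, b.sum_sq_inner_left,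
    norm_sq_eq_rho hd, hf x, Complex.norm_real, Real.norm_eq_abs, sq_abs, mul_pow (bubble d x),
    bubble_sq hd]
  have h4 : (d : ℝ) - 2 ≠ 0 := by linarith
  have := rho_pos hd x
  field_simp
  ring

end NegativeDirection

section NegativeDirectionExists

open scoped ContDiff SchwartzMap LineDeriv Topology
open SchwartzMap LineDeriv Module Filter

set_option linter.unusedSectionVars false

variable {E : Type*} [NormedAddCommGroup E] [InnerProductSpace ℝ E] [FiniteDimensional ℝ E]
  [MeasurableSpace E] [BorelSpace E] {d : ℕ}

/-- A compactly supported smooth truncation of the identity. -/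
def cutoffId (t : ℝ) : ℝ := t * (⟨1, 2, one_pos, one_lt_two⟩ : ContDiffBump (0 : ℝ)) t

theorem contDiff_cutoffId : ContDiff ℝ ∞ cutoffId :=
  contDiff_id.mul (ContDiffBump.contDiff _)

theorem hasCompactSupport_cutoffId : HasCompactSupport cutoffId :=
  (ContDiffBump.hasCompactSupport _).mul_left

theorem cutoffId_eq_zero {t : ℝ} (ht : 2 ≤ |t|) : cutoffId t = 0 := by
  rw [cutoffId, ContDiffBump.zero_of_le_dist _ (by simpa using ht), mul_zero]

theorem deriv_cutoffId_zero : deriv cutoffId 0 = 1 := by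
  set χ : ContDiffBump (0 : ℝ) := ⟨1, 2, one_pos, one_lt_two⟩ with hχ
  have h1 : χ 0 = 1 := χ.one_of_mem_closedBall (by simp [hχ])
  have h : HasDerivAt cutoffId (1 * χ 0 + 0 * deriv χ 0) 0 :=
    (hasDerivAt_id (0 : ℝ)).mul
      ((χ.contDiff (n := 1)).differentiable one_ne_zero).differentiableAt.hasDerivAt
  simpa [h1] using h.deriv

theorem exists_one_add_abs_mul_le {g : ℝ → ℝ} (hg : Continuous g) (hc : HasCompactSupport g) :
    ∃ C, ∀ s, (1 + |s|) * |g s| ≤ C := by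
  obtain ⟨C, hC⟩ := (((continuous_const.add continuous_abs).mul hg :
    Continuous fun s => (1 + |s|) * g s)).bounded_above_of_compact_support hc.mul_left
  refine ⟨C, fun s => ?_⟩
  have h : |(1 + |s|) * g s| ≤ C := hC s
  rwa [abs_mul, abs_of_nonneg (add_nonneg zero_le_one (abs_nonneg s))] at h

/-- `radialOp` of a truncated and dilated translate of the identity, where `q` is the derivative
of the truncation. -/
def truncRadial (d : ℕ) (q : ℝ → ℝ) (ε : ℝ) (t : ℝ) : ℝ :=
  radialOp d (fun t => q (ε * (t - 1))) (fun t => ε * deriv q (ε * (t - 1))) t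

/-- The derivative of `truncRadial`. -/
def truncRadial' (d : ℕ) (q : ℝ → ℝ) (ε : ℝ) (t : ℝ) : ℝ :=
  ε * (4 * deriv q (ε * (t - 1)) + 4 * (ε * (t - 1)) * deriv (deriv q) (ε * (t - 1))) +
    4 * ((d : ℝ) - 2) * -(t⁻¹ ^ 2) * q (ε * (t - 1)) +
    (2 * d - 4 * ((d : ℝ) - 2) * (1 - t⁻¹)) * (ε * deriv q (ε * (t - 1)))

theorem hasDerivAt_comp_dilate {u : ℝ → ℝ} (hu : Differentiable ℝ u) (ε t : ℝ) :
    HasDerivAt (fun t => u (ε * (t - 1))) (ε * deriv u (ε * (t - 1))) t := by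
  have h : HasDerivAt (fun t => u (ε * (t - 1))) (deriv u (ε * (t - 1)) * (ε * 1)) t :=
    (hu (ε * (t - 1))).hasDerivAt.comp t (((hasDerivAt_id t).sub_const 1).const_mul ε)
  rwa [mul_one, mul_comm] at h

theorem hasDerivAt_truncRadial (d : ℕ) {q : ℝ → ℝ} (hq : ContDiff ℝ ∞ q) (ε : ℝ) {t : ℝ}
    (ht : 1 ≤ t) : HasDerivAt (truncRadial d q ε) (truncRadial' d q ε t) t := by
  have hq0 : Differentiable ℝ q := hq.differentiable (by simp)
  have hq1 : Differentiable ℝ (deriv q) :=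
    (contDiff_infty_iff_deriv.1 hq).2.differentiable (by simp)
  have ht0 : t ≠ 0 := by linarith
  have h1 := (((hasDerivAt_id t).sub_const 1).const_mul 4).mul
    ((hasDerivAt_comp_dilate hq1 ε t).const_mul ε)
  have h2 := ((((hasDerivAt_inv ht0).const_sub 1).const_mul (4 * ((d : ℝ) - 2))).const_sub
    (2 * (d : ℝ))).mul (hasDerivAt_comp_dilate hq0 ε t)
  refine (h1.add h2).congr_deriv ?_
  simp only [truncRadial', id]
  field_simp
  ring

theorem exists_truncRadial_bound (hd : 2 < d) {q : ℝ → ℝ} (hq : ContDiff ℝ ∞ q)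
    (hc : HasCompactSupport q) :
    ∃ C, ∀ ε ∈ Set.Ioc (0 : ℝ) 1, ∀ t, 1 ≤ t →
      |truncRadial d q ε t| ≤ C ∧ |truncRadial' d q ε t| ≤ C * t⁻¹ := by
  have h2 : (2 : ℝ) < d := by exact_mod_cast hd
  have hq1 : ContDiff ℝ ∞ (deriv q) := (contDiff_infty_iff_deriv.1 hq).2
  have hq2 : ContDiff ℝ ∞ (deriv (deriv q)) := (contDiff_infty_iff_deriv.1 hq1).2
  obtain ⟨C₀, h₀⟩ := exists_one_add_abs_mul_le hq.continuous hc
  obtain ⟨C₁, h₁⟩ := exists_one_add_abs_mul_le hq1.continuous hc.deriv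
  obtain ⟨C₂, h₂⟩ := exists_one_add_abs_mul_le (continuous_id.mul hq2.continuous)
    hc.deriv.deriv.mul_left
  refine ⟨4 * C₁ + 4 * C₂ + 4 * d * C₀ + 6 * d * (C₀ + C₁), fun ε hε t ht => ?_⟩
  obtain ⟨hε0, hε1⟩ := hε
  have ht0 : 0 < t := by linarith
  have hti : t⁻¹ ≤ 1 := inv_le_one_of_one_le₀ ht
  have hti0 : 0 < t⁻¹ := by positivity
  set s := ε * (t - 1) with hs
  have hs0 : 0 ≤ s := mul_nonneg hε0.le (by linarith)
  have hk : |2 * (d : ℝ) - 4 * ((d : ℝ) - 2) * (1 - t⁻¹)| ≤ 6 * d := by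
    have : 0 ≤ ((d : ℝ) - 2) * (1 - t⁻¹) := mul_nonneg (by linarith) (by linarith)
    have : 0 ≤ ((d : ℝ) - 2) * t⁻¹ := mul_nonneg (by linarith) hti0.le
    rw [abs_le]
    constructor <;> linarith
  have h₀ := h₀ s
  have h₁ := h₁ s
  have h₂ := h₂ s
  simp only [Pi.mul_apply, id] at h₂
  rw [abs_of_nonneg hs0] at h₀ h₁ h₂
  have hts : ε * t ≤ 1 + s := by rw [hs]; linarith
  have hst : ∀ {x C : ℝ}, (1 + s) * |x| ≤ C → ε * |x| ≤ C * t⁻¹ := fun {x C} h => by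
    rw [← div_eq_mul_inv, le_div_iff₀ ht0]
    nlinarith [abs_nonneg x]
  have hle : ∀ {x C : ℝ}, (1 + s) * |x| ≤ C → |x| ≤ C := fun {x C} h => by
    nlinarith [abs_nonneg x]
  have hsle : ∀ {x C : ℝ}, (1 + s) * |x| ≤ C → s * |x| ≤ C := fun {x C} h => by
    nlinarith [abs_nonneg x]
  have hC₀ : 0 ≤ C₀ := (abs_nonneg _).trans (hle h₀)
  have hC₁ : 0 ≤ C₁ := (abs_nonneg _).trans (hle h₁)
  have hC₂ : 0 ≤ C₂ := (abs_nonneg _).trans (hle h₂)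
  have hd0 : (0 : ℝ) < d := by linarith
  constructor
  · have e : truncRadial d q ε t = 4 * (s * deriv q s) +
        (2 * (d : ℝ) - 4 * ((d : ℝ) - 2) * (1 - t⁻¹)) * q s := by
      rw [truncRadial, radialOp, hs]
      ring
    rw [e]
    calc _ ≤ |4 * (s * deriv q s)| + |(2 * (d : ℝ) - 4 * ((d : ℝ) - 2) * (1 - t⁻¹)) * q s| :=
          abs_add_le _ _
      _ = 4 * (s * |deriv q s|) + |2 * (d : ℝ) - 4 * ((d : ℝ) - 2) * (1 - t⁻¹)| * |q s| := by
          rw [abs_mul 4, abs_mul s, abs_mul _ (q s), abs_of_nonneg hs0,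
            abs_of_pos (by norm_num : (0 : ℝ) < 4)]
      _ ≤ 4 * C₁ + 6 * d * C₀ := by
          gcongr
          exacts [hsle h₁, hle h₀]
      _ ≤ _ := by
          have : 0 ≤ d * C₁ := by positivity
          have : 0 ≤ d * C₀ := by positivity
          linarith
  · have e : truncRadial' d q ε t = 4 * (ε * deriv q s) + 4 * (ε * (s * deriv (deriv q) s)) +
        -(4 * ((d : ℝ) - 2) * t⁻¹ ^ 2 * q s) +
        (2 * (d : ℝ) - 4 * ((d : ℝ) - 2) * (1 - t⁻¹)) * (ε * deriv q s) := by
      rw [truncRadial', hs]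
      ring
    rw [e]
    have a₁ : |4 * (ε * deriv q s)| ≤ 4 * (C₁ * t⁻¹) := by
      rw [abs_mul, abs_mul, abs_of_pos hε0, abs_of_pos (by norm_num : (0 : ℝ) < 4)]
      exact mul_le_mul_of_nonneg_left (hst h₁) (by norm_num)
    have a₂ : |4 * (ε * (s * deriv (deriv q) s))| ≤ 4 * (C₂ * t⁻¹) := by
      rw [abs_mul, abs_mul, abs_of_pos hε0, abs_of_pos (by norm_num : (0 : ℝ) < 4)]
      exact mul_le_mul_of_nonneg_left (hst h₂) (by norm_num)
    have a₃ : |-(4 * ((d : ℝ) - 2) * t⁻¹ ^ 2 * q s)| ≤ 4 * d * C₀ * t⁻¹ := by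
      rw [abs_neg, abs_mul, abs_of_nonneg (mul_nonneg (by linarith) (by positivity))]
      calc 4 * ((d : ℝ) - 2) * t⁻¹ ^ 2 * |q s| ≤ 4 * d * t⁻¹ * C₀ := by
            have : t⁻¹ ^ 2 ≤ t⁻¹ := by nlinarith
            gcongr
            exacts [by linarith, hle h₀]
        _ = _ := by ring
    have a₄ : |(2 * (d : ℝ) - 4 * ((d : ℝ) - 2) * (1 - t⁻¹)) * (ε * deriv q s)| ≤
        6 * d * (C₁ * t⁻¹) := by
      rw [abs_mul, abs_mul, abs_of_pos hε0]
      exact mul_le_mul hk (hst h₁) (by positivity) (by positivity)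
    have a₅ : 0 ≤ 6 * d * C₀ * t⁻¹ := by positivity
    refine ((abs_add_le _ _).trans (add_le_add ((abs_add_le _ _).trans
      (add_le_add ((abs_add_le _ _).trans (add_le_add a₁ a₂)) a₃)) a₄)).trans ?_
    linarith

theorem tendsto_truncRadial (d : ℕ) {q : ℝ → ℝ} (hq : ContDiff ℝ ∞ q) (hq1 : q 0 = 1) (t : ℝ) :
    Tendsto (fun ε => truncRadial d q ε t) (𝓝 0)
      (𝓝 (2 * d - 4 * ((d : ℝ) - 2) * (1 - t⁻¹))) := by
  have hq' : Continuous (deriv q) := (contDiff_infty_iff_deriv.1 hq).2.continuous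
  have hq0 := hq.continuous
  have h : Continuous fun ε => truncRadial d q ε t := by
    unfold truncRadial radialOp
    fun_prop
  simpa [truncRadial, radialOp, hq1] using h.tendsto 0

theorem tendsto_truncRadial' (d : ℕ) {q : ℝ → ℝ} (hq : ContDiff ℝ ∞ q) (hq1 : q 0 = 1) (t : ℝ) :
    Tendsto (fun ε => truncRadial' d q ε t) (𝓝 0) (𝓝 (-(4 * ((d : ℝ) - 2)) * t⁻¹ ^ 2)) := by
  have hc := (contDiff_infty_iff_deriv.1 hq).2
  have hq' : Continuous (deriv q) := hc.continuous
  have hq'' : Continuous (deriv (deriv q)) := (contDiff_infty_iff_deriv.1 hc).2.continuous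
  have hq0 := hq.continuous
  have h : Continuous fun ε => truncRadial' d q ε t := by
    unfold truncRadial'
    fun_prop
  simpa [truncRadial', hq1] using h.tendsto 0

theorem exists_integral_truncRadial_neg (hd : 2 < d) (b : OrthonormalBasis (Fin d) ℝ E)
    {q : ℝ → ℝ} (hq : ContDiff ℝ ∞ q) (hc : HasCompactSupport q) (hq1 : q 0 = 1) :
    ∃ ε : ℝ, 0 < ε ∧ ∫ x : E, (rho d x)⁻¹ ^ (d - 2) *
      ((rho d x - 1) * truncRadial' d q ε (rho d x) ^ 2 / d -
        (rho d x)⁻¹ ^ 2 * truncRadial d q ε (rho d x) ^ 2) < 0 := by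
  have hE : finrank ℝ E = d := by rw [finrank_eq_card_basis b.toBasis, Fintype.card_fin]
  obtain ⟨C, hC⟩ := exists_truncRadial_bound hd hq hc
  have hd1 : (1 : ℝ) ≤ d := by exact_mod_cast (by omega : 1 ≤ d)
  have hIoc : ∀ᶠ ε in 𝓝[>] (0 : ℝ), ε ∈ Set.Ioc (0 : ℝ) 1 := Ioc_mem_nhdsGT one_pos
  have hq' := (contDiff_infty_iff_deriv.1 hq).2
  have hc0 := hq.continuous
  have hc1 : Continuous (deriv q) := hq'.continuous
  have hc2 : Continuous (deriv (deriv q)) := (contDiff_infty_iff_deriv.1 hq').2.continuous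
  have hr : Continuous (rho d : E → ℝ) := (contDiff_rho d).continuous
  have hri := continuous_inv_rho (E := E) hd
  have hlim : Tendsto (fun ε => ∫ x : E, (rho d x)⁻¹ ^ (d - 2) *
      ((rho d x - 1) * truncRadial' d q ε (rho d x) ^ 2 / d -
        (rho d x)⁻¹ ^ 2 * truncRadial d q ε (rho d x) ^ 2)) (𝓝[>] 0)
      (𝓝 (∫ x : E, (rho d x)⁻¹ ^ (d - 2) * ((rho d x - 1) *
        (-(4 * ((d : ℝ) - 2)) * (rho d x)⁻¹ ^ 2) ^ 2 / d -
        (rho d x)⁻¹ ^ 2 * (2 * d - 4 * ((d : ℝ) - 2) * (1 - (rho d x)⁻¹)) ^ 2))) := by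
    refine tendsto_integral_filter_of_dominated_convergence
      (fun x => 2 * C ^ 2 * (rho d x)⁻¹ ^ (d - 1)) (.of_forall fun ε => ?_) ?_
      ((integrable_inv_rho_pow hd (by omega)).const_mul _) (.of_forall fun x =>
        tendsto_const_nhds.mul (((tendsto_const_nhds.mul
          (((tendsto_truncRadial' d hq hq1 (rho d x)).mono_left nhdsWithin_le_nhds).pow 2)).div_const
            _).sub (tendsto_const_nhds.mul
            (((tendsto_truncRadial d hq hq1 (rho d x)).mono_left nhdsWithin_le_nhds).pow 2))))
    · refine Continuous.aestronglyMeasurable ?_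
      unfold truncRadial' truncRadial radialOp
      fun_prop
    · filter_upwards [hIoc] with ε hε
      refine .of_forall fun x => ?_
      obtain ⟨h1, h2⟩ := hC ε hε _ (one_le_rho hd x)
      have hρ := one_le_rho hd x
      have hi0 := inv_rho_pos hd x
      have hi1 := inv_rho_le_one hd x
      have hρi : rho d x * (rho d x)⁻¹ = 1 := mul_inv_cancel₀ (by linarith)
      have e1 := sq_le_sq' (abs_le.1 h1).1 (abs_le.1 h1).2
      have e2 := sq_le_sq' (abs_le.1 h2).1 (abs_le.1 h2).2
      have b1 : (rho d x - 1) * truncRadial' d q ε (rho d x) ^ 2 / d ≤ C ^ 2 * (rho d x)⁻¹ :=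
        calc _ ≤ (rho d x - 1) * truncRadial' d q ε (rho d x) ^ 2 :=
              div_le_self (mul_nonneg (by linarith) (sq_nonneg _)) hd1
          _ ≤ rho d x * (C * (rho d x)⁻¹) ^ 2 := by
              gcongr
              linarith
          _ = rho d x * (rho d x)⁻¹ * (C ^ 2 * (rho d x)⁻¹) := by ring
          _ = _ := by rw [hρi, one_mul]
      have b2 : (rho d x)⁻¹ ^ 2 * truncRadial d q ε (rho d x) ^ 2 ≤ C ^ 2 * (rho d x)⁻¹ :=
        calc _ ≤ (rho d x)⁻¹ * C ^ 2 := by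
              gcongr
              nlinarith
          _ = _ := mul_comm _ _
      have n1 : 0 ≤ (rho d x - 1) * truncRadial' d q ε (rho d x) ^ 2 / d :=
        div_nonneg (mul_nonneg (by linarith) (sq_nonneg _)) (by linarith)
      have n2 : 0 ≤ (rho d x)⁻¹ ^ 2 * truncRadial d q ε (rho d x) ^ 2 := by positivity
      have hp : (rho d x)⁻¹ ^ (d - 1) = (rho d x)⁻¹ ^ (d - 2) * (rho d x)⁻¹ := by
        rw [← pow_succ]
        congr 1
        omega
      rw [norm_mul, Real.norm_of_nonneg (by positivity), hp]
      calc _ ≤ (rho d x)⁻¹ ^ (d - 2) * (2 * (C ^ 2 * (rho d x)⁻¹)) := by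
            gcongr
            rw [Real.norm_eq_abs, abs_le]
            constructor <;> linarith
        _ = _ := by ring
  obtain ⟨ε, hε, hε0⟩ := ((hlim.eventually_lt_const (integral_limit_neg hd b)).and hIoc).exists
  exact ⟨ε, hε0.1, hε⟩

theorem exists_schwartz_bubble_mul (hd : 2 < d) {ε : ℝ} (hε : 0 < ε) :
    ∃ f : 𝓢(E, ℂ), ∀ y, f y =
      ((bubble d y * (ε⁻¹ * cutoffId (ε * (rho d y - 1))) : ℝ) : ℂ) := by
  have hθ := dim_pos hd
  have hs : HasCompactSupport fun y : E =>
      ((bubble d y * (ε⁻¹ * cutoffId (ε * (rho d y - 1))) : ℝ) : ℂ) := by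
    refine HasCompactSupport.intro (isCompact_closedBall (0 : E)
      (2 * ((d : ℝ) * ((d : ℝ) - 2)) / ε + 1)) fun x hx => ?_
    rw [cutoffId_eq_zero, mul_zero, mul_zero, Complex.ofReal_zero]
    rw [Metric.mem_closedBall, dist_zero_right, not_le] at hx
    have h0 : 0 < 2 * ((d : ℝ) * ((d : ℝ) - 2)) / ε := by positivity
    have h1 : 2 * ((d : ℝ) * ((d : ℝ) - 2)) / ε ≤ ‖x‖ ^ 2 := by nlinarith
    rw [div_le_iff₀ hε] at h1
    refine le_trans ?_ (le_abs_self _)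
    rw [rho, add_sub_cancel_left, mul_div_assoc', le_div_iff₀ hθ]
    linarith
  exact ⟨hs.toSchwartzMap (Complex.ofRealCLM.contDiff.comp ((contDiff_bubble hd).mul
    (contDiff_const.mul (contDiff_cutoffId.comp
      (contDiff_const.mul ((contDiff_rho d).sub contDiff_const)))))), fun _ => rfl⟩

theorem exists_quadForm_linearized_neg (hd : 2 < d) (b : OrthonormalBasis (Fin d) ℝ E) :
    ∃ φ : 𝓢(E, ℂ), quadForm
      (schrodinger fun x : E => (rho d x)⁻¹ ^ 2 + 4 / ((d : ℝ) - 2) * (rho d x)⁻¹ ^ 2)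
      (schrodinger (fun x : E => (rho d x)⁻¹ ^ 2) φ) < 0 := by
  have hF := contDiff_cutoffId
  have hq : ContDiff ℝ ∞ (deriv cutoffId) := (contDiff_infty_iff_deriv.1 hF).2
  obtain ⟨ε, hε, hneg⟩ := exists_integral_truncRadial_neg hd b hq
    hasCompactSupport_cutoffId.deriv deriv_cutoffId_zero
  obtain ⟨φ, hφ⟩ := exists_schwartz_bubble_mul (E := E) hd hε
  refine ⟨φ, ?_⟩
  have hu : ∀ t, HasDerivAt (fun t => ε⁻¹ * cutoffId (ε * (t - 1)))
      (deriv cutoffId (ε * (t - 1))) t := fun t => by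
    have h := (hasDerivAt_comp_dilate (hF.differentiable (by simp)) ε t).const_mul ε⁻¹
    rwa [inv_mul_cancel_left₀ hε.ne'] at h
  rw [quadForm_linearized hd b (schrodinger_apply_comp_rho hd b hφ hu
    (hasDerivAt_comp_dilate (hq.differentiable (by simp)) ε))
    fun t ht => hasDerivAt_truncRadial d hq ε ht]
  have h2 : (2 : ℝ) < d := by exact_mod_cast hd
  have hθ := dim_pos hd
  have h4 : 0 < 4 / ((d : ℝ) - 2) := div_pos (by norm_num) (by linarith)
  exact mul_neg_of_pos_of_neg
    (mul_pos (sq_pos_of_ne_zero (neg_ne_zero.2 (inv_ne_zero hθ.ne'))) h4) hneg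

end NegativeDirectionExists

section RealEigenfunction

open scoped ContDiff SchwartzMap Laplacian ComplexConjugate
open SchwartzMap Module

set_option linter.unusedSectionVars false

variable {E : Type*} [NormedAddCommGroup E] [InnerProductSpace ℝ E] [FiniteDimensional ℝ E]
  [MeasurableSpace E] [BorelSpace E] {d : ℕ}

/-- Complex conjugation of Schwartz functions. -/
def conjOp : 𝓢(E, ℂ) →L[ℝ] 𝓢(E, ℂ) := postcompCLM (Complex.conjCLE : ℂ →L[ℝ] ℂ)

theorem conjOp_apply (f : 𝓢(E, ℂ)) (x : E) : conjOp f x = conj (f x) := rfl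

theorem conjOp_smul (c : ℂ) (f : 𝓢(E, ℂ)) : conjOp (c • f) = conj c • conjOp f := by
  ext x
  simp [conjOp_apply]

theorem conjOp_conjOp (f : 𝓢(E, ℂ)) : conjOp (conjOp f) = f := by
  ext x
  simp [conjOp_apply]

theorem schrodinger_apply {V : E → ℝ} (hV : (fun x => (V x : ℂ)).HasTemperateGrowth)
    (f : 𝓢(E, ℂ)) (x : E) : schrodinger V f x = -Δ (f : E → ℂ) x - V x * f x := by
  rw [schrodinger, _root_.sub_apply, _root_.sub_apply, _root_.neg_apply, _root_.neg_apply,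
    lapOp_apply, laplacian_apply, smulLeftCLM_apply_apply hV, smul_eq_mul]

theorem schrodinger_conjOp {V : E → ℝ} (hV : (fun x => (V x : ℂ)).HasTemperateGrowth)
    (f : 𝓢(E, ℂ)) : schrodinger V (conjOp f) = conjOp (schrodinger V f) := by
  ext x
  have h : Δ (conjOp f : E → ℂ) x = conj (Δ (f : E → ℂ) x) :=
    (f.smooth 2).contDiffAt.laplacian_CLM_comp_left (l := (Complex.conjCLE : ℂ →L[ℝ] ℂ))
  simp only [schrodinger_apply hV, conjOp_apply, h, map_sub, map_neg, map_mul, Complex.conj_ofReal]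

theorem exists_conjOp_eq_self {T : 𝓢(E, ℂ) →L[ℂ] 𝓢(E, ℂ)} (hT : ∀ f, T (conjOp f) = conjOp (T f))
    {g : 𝓢(E, ℂ)} (hg : g ≠ 0) (hTg : T g = 0) : ∃ v, v ≠ 0 ∧ conjOp v = v ∧ T v = 0 := by
  by_cases h : g + conjOp g = 0
  · refine ⟨Complex.I • g, smul_ne_zero Complex.I_ne_zero hg, ?_, by rw [map_smul, hTg, smul_zero]⟩
    rw [conjOp_smul, Complex.conj_I, neg_smul, ← smul_neg, ← eq_neg_of_add_eq_zero_left h]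
  · refine ⟨g + conjOp g, h, ?_, by rw [map_add, hT, hTg, map_zero, add_zero]⟩
    rw [map_add, conjOp_conjOp, add_comm]

/-- The linearization around the ground state, written as a system for real and imaginary parts,
has a positive eigenvalue. -/
theorem exists_real_eigenpair (hd : 2 < d) (b : OrthonormalBasis (Fin d) ℝ E) :
    ∃ e : ℝ, 0 < e ∧ ∃ v w : 𝓢(E, ℂ), v ≠ 0 ∧ conjOp v = v ∧ conjOp w = w ∧
      schrodinger (fun x : E => (rho d x)⁻¹ ^ 2 + 4 / ((d : ℝ) - 2) * (rho d x)⁻¹ ^ 2) v =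
        (e : ℂ) • w ∧
      schrodinger (fun x : E => (rho d x)⁻¹ ^ 2) w = -(e : ℂ) • v := by
  have h2 : (2 : ℝ) < d := by exact_mod_cast hd
  have hV := isSymbol_inv_rho_sq (E := E) hd
  have hU := isSymbol_const_mul_inv_rho_sq (E := E) hd (4 / ((d : ℝ) - 2))
  have hVU : (fun x : E => (((rho d x)⁻¹ ^ 2 + 4 / ((d : ℝ) - 2) * (rho d x)⁻¹ ^ 2 : ℝ) :
      ℂ)).HasTemperateGrowth := by
    simp only [Complex.ofReal_add]
    exact hV.hasTemperateGrowth.add hU.hasTemperateGrowth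
  obtain ⟨m, hm, g, hg, hLg⟩ := exists_schrodinger_eigenfunction hV hU
    (fun x => mul_nonneg (div_nonneg (by norm_num) (by linarith)) (sq_nonneg _))
    (fun f => by
      rw [quadForm_schrodinger_eq_sum hd b]
      positivity)
    (exists_quadForm_linearized_neg hd b)
  have hconj := schrodinger_conjOp hV.hasTemperateGrowth
  have hconj' := schrodinger_conjOp hVU
  set L := schrodinger fun x : E => (rho d x)⁻¹ ^ 2
  set P := schrodinger fun x : E => (rho d x)⁻¹ ^ 2 + 4 / ((d : ℝ) - 2) * (rho d x)⁻¹ ^ 2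
  obtain ⟨v, hv, hvc, hTv⟩ := exists_conjOp_eq_self (T := L * P + (m : ℂ) • 1)
    (fun f => by
      simp only [_root_.add_apply, _root_.smul_apply, mul_apply_eq_comp,
        one_apply_eq_self, hconj, hconj', map_add, conjOp_smul, Complex.conj_ofReal])
    hg hLg
  have hTv' : L (P v) = -(m : ℂ) • v := by
    rw [neg_smul]
    exact eq_neg_of_add_eq_zero_left hTv
  have he := Real.sqrt_pos.2 hm
  have he0 : (√m : ℂ) ≠ 0 := by exact_mod_cast he.ne'
  have hem : (m : ℂ) = √m * √m := by exact_mod_cast (Real.mul_self_sqrt hm.le).symm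
  refine ⟨√m, he, v, (√m : ℂ)⁻¹ • P v, hv, hvc, ?_, ?_, ?_⟩
  · rw [conjOp_smul, ← hconj', hvc, map_inv₀, Complex.conj_ofReal]
  · rw [smul_inv_smul₀ he0]
  · rw [map_smul, hTv', smul_smul, mul_neg, hem, inv_mul_cancel_left₀ he0]

end RealEigenfunction

section Linearized

open scoped SchwartzMap Laplacian ComplexConjugate
open SchwartzMap

variable {d : ℕ}

theorem lap_eq_laplacian (f : Euc d → ℂ) (x : Euc d) : lap f x = Δ f x := by
  rw [InnerProductSpace.laplacian_eq_iteratedFDeriv_orthonormalBasis f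
    (EuclideanSpace.basisFun (Fin d) ℝ)]
  simp [lap]

theorem pc_sub_one (hd : 2 < d) : pc d - 1 = 4 / ((d : ℝ) - 2) := by
  have h2 : (2 : ℝ) < d := by exact_mod_cast hd
  have h3 : (d : ℝ) - 2 ≠ 0 := by linarith
  rw [pc]
  field_simp
  ring

theorem Wgs_rpow (hd : 2 < d) (x : Euc d) : Wgs d x ^ (pc d - 1) = (rho d x)⁻¹ ^ 2 := by
  have h2 : (2 : ℝ) < d := by exact_mod_cast hd
  have h3 : (d : ℝ) - 2 ≠ 0 := by linarith
  have h := rho_pos hd x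
  have e : -(((d : ℝ) - 2) / 2) * (4 / ((d : ℝ) - 2)) = -(2 : ℕ) := by
    field_simp
    norm_num
  rw [pc_sub_one hd]
  change (rho d x ^ (-(((d : ℝ) - 2) / 2))) ^ (4 / ((d : ℝ) - 2)) = _
  rw [← Real.rpow_mul h.le, e, Real.rpow_neg h.le, Real.rpow_natCast, inv_pow]

/-- The linearized operator acts on `v + i s w`, with `v` and `w` real and `s = ±1`, through the
two associated Schrödinger operators. -/
theorem Lop_eq (hd : 2 < d) {v w : 𝓢(Euc d, ℂ)} {e s : ℂ} (hs : s * s = 1) (hsc : conj s = s)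
    (hv : conjOp v = v) (hw : conjOp w = w)
    (hPv : schrodinger (fun x : Euc d =>
      (rho d x)⁻¹ ^ 2 + 4 / ((d : ℝ) - 2) * (rho d x)⁻¹ ^ 2) v = e • w)
    (hLw : schrodinger (fun x : Euc d => (rho d x)⁻¹ ^ 2) w = -e • v) (x : Euc d) :
    Lop d (v + (Complex.I * s) • w : 𝓢(Euc d, ℂ)) x =
      s * e * (v + (Complex.I * s) • w : 𝓢(Euc d, ℂ)) x := by
  have hV := isSymbol_inv_rho_sq (E := Euc d) hd
  have hU := isSymbol_const_mul_inv_rho_sq (E := Euc d) hd (4 / ((d : ℝ) - 2))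
  have hVU : (fun x : Euc d => (((rho d x)⁻¹ ^ 2 + 4 / ((d : ℝ) - 2) * (rho d x)⁻¹ ^ 2 : ℝ) :
      ℂ)).HasTemperateGrowth := by
    simp only [Complex.ofReal_add]
    exact hV.hasTemperateGrowth.add hU.hasTemperateGrowth
  have h1 := DFunLike.congr_fun hPv x
  have h2 := DFunLike.congr_fun hLw x
  rw [schrodinger_apply hVU, _root_.smul_apply, smul_eq_mul] at h1
  rw [schrodinger_apply hV.hasTemperateGrowth, _root_.smul_apply, smul_eq_mul] at h2
  have h3 : conj (v x) = v x := DFunLike.congr_fun hv x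
  have h4 : conj (w x) = w x := DFunLike.congr_fun hw x
  have h5 : lap (v + (Complex.I * s) • w : 𝓢(Euc d, ℂ)) x =
      Δ (v : Euc d → ℂ) x + Complex.I * s * Δ (w : Euc d → ℂ) x := by
    rw [lap_eq_laplacian, ← laplacian_apply, ← laplacian_apply, ← laplacian_apply, ← lapOp_apply,
      map_add, map_smul]
    simp
  have h6 : ((pc d + 1) / 2 : ℝ) = 1 + 4 / ((d : ℝ) - 2) / 2 := by
    linarith [pc_sub_one hd]
  have h7 : ((v + (Complex.I * s) • w : 𝓢(Euc d, ℂ)) : Euc d → ℂ) x =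
    v x + Complex.I * s * w x := rfl
  rw [Lop, h5, h7, map_add, map_mul, map_mul, h3, h4, hsc, Complex.conj_I, Wgs_rpow hd, h6,
    pc_sub_one hd]
  push_cast at h1 h2 ⊢
  linear_combination Complex.I * h1 + Complex.I * Complex.I * s * h2 -
    Complex.I * e * w x * hs - s * e * v x * Complex.I_mul_I

end Linearized

/-- ℒ has eigenfunctions 𝒴₊ = conj 𝒴₋ in Schwartz class with
eigenvalues ±e₀, e₀ > 0. -/
theorem linearized_eigenfunctions (d : ℕ) (hd : 6 ≤ d) :
    ∃ (e₀ : ℝ) (Yp Ym : SchwartzMap (Euc d) ℂ),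
      0 < e₀ ∧ Yp ≠ 0 ∧ Ym ≠ 0 ∧
      (∀ x : Euc d, Yp x = starRingEnd ℂ (Ym x)) ∧
      (∀ x : Euc d, Lop d (⇑Yp) x = (e₀ : ℂ) * Yp x) ∧
      (∀ x : Euc d, Lop d (⇑Ym) x = -(e₀ : ℂ) * Ym x) := by
  obtain ⟨e, he, v, w, hv0, hv, hw, hPv, hLw⟩ :=
    exists_real_eigenpair (by omega : 2 < d) (EuclideanSpace.basisFun (Fin d) ℝ)
  have hd2 : 2 < d := by omega
  have hconj : ∀ s : ℂ, starRingEnd ℂ s = s →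
      conjOp (v + (Complex.I * s) • w) = v + (Complex.I * -s) • w := fun s hs => by
    rw [map_add, conjOp_smul, hv, hw, map_mul, hs, Complex.conj_I, mul_neg, neg_mul]
  have hne : ∀ s : ℂ, starRingEnd ℂ s = s → v + (Complex.I * s) • w ≠ 0 := fun s hs h => by
    have h1 := hconj s hs
    rw [h, map_zero] at h1
    have h2 : (2 : ℂ) • v = 0 := by
      calc (2 : ℂ) • v = (v + (Complex.I * s) • w) + (v + (Complex.I * -s) • w) := by
            rw [mul_neg, neg_smul, two_smul]
            abel
        _ = 0 := by rw [h, ← h1, add_zero]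
    exact hv0 ((smul_eq_zero.1 h2).resolve_left two_ne_zero)
  refine ⟨e, v + (Complex.I * 1) • w, v + (Complex.I * -1) • w, he, hne 1 (map_one _),
    hne (-1) (by simp), fun x => ?_, fun x => ?_, fun x => ?_⟩
  · have h := DFunLike.congr_fun (hconj (-1) (by simp)) x
    rw [neg_neg] at h
    exact h.symm
  · rw [Lop_eq hd2 (s := 1) (by norm_num) (map_one _) hv hw hPv hLw, one_mul]
  · rw [Lop_eq hd2 (s := -1) (by norm_num) (by simp) hv hw hPv hLw, neg_one_mul]
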